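/- arXiv:1507.04499 — 7 statements merged into one kernel-verified Lean document; each statement's English description precedes it below -/
import Mathlib

section
/- For every positive integer h, every positive integer k, and every y ∈ [0,1], the sum of absolute values of the iterated Bernstein basis functions is bounded: ∑_{ν=0}^{k} |b^{(h)}_{ν,k}(y)| ≤ 2^h − 1. -/
open Finset

/-- The Bernstein basis polynomial `b_{ν,k}(y) = C(k,ν) y^ν (1-y)^(k-ν)`. -/
noncomputable def bernsteinBasis (k ν : ℕ) (y : ℝ) : ℝ :=
  (k.choose ν : ℝ) * y ^ ν * (1 - y) ^ (k - ν)

/-- The Bernstein operator: `B_k(f; y) = ∑_{ν=0}^k f(ν/k) b_{ν,k}(y)`. -/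
noncomputable def bernsteinOp (k : ℕ) (f : ℝ → ℝ) (y : ℝ) : ℝ :=
  ∑ ν ∈ Finset.range (k + 1), f ((ν : ℝ) / (k : ℝ)) * bernsteinBasis k ν y

/-- The iterated Bernstein basis functions of order `h`:
`b^{(h)}_{ν,k}(y) = ∑_{i=1}^h C(h,i) (-1)^{i-1} B_k^{i-1}(b_{ν,k}; y)`. -/
noncomputable def iterBernsteinBasis (h k ν : ℕ) (y : ℝ) : ℝ :=
  ∑ i ∈ Finset.Icc 1 h,
    (h.choose i : ℝ) * (-1 : ℝ) ^ (i - 1) * ((bernsteinOp k)^[i - 1] (bernsteinBasis k ν)) y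

theorem aux_basis_nonneg (k ν : ℕ) (y : ℝ) (hy : y ∈ Set.Icc (0 : ℝ) 1) :
    0 ≤ bernsteinBasis k ν y := by
  have h0 := hy.1
  have h1 : 0 ≤ 1 - y := by linarith [hy.2]
  unfold bernsteinBasis
  positivity

theorem aux_basis_sum (k : ℕ) (y : ℝ) :
    ∑ ν ∈ Finset.range (k + 1), bernsteinBasis k ν y = 1 := by
  have h := add_pow y (1 - y) k
  rw [add_sub_cancel, one_pow] at h
  rw [h]
  refine Finset.sum_congr rfl fun ν _ => ?_
  unfold bernsteinBasis
  ring

theorem aux_node (k ν : ℕ) (hν : ν ∈ Finset.range (k + 1)) :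
    (ν : ℝ) / (k : ℝ) ∈ Set.Icc (0 : ℝ) 1 := by
  have h : ν ≤ k := Nat.lt_succ_iff.mp (Finset.mem_range.mp hν)
  exact ⟨by positivity, div_le_one_of_le₀ (by exact_mod_cast h) (by positivity)⟩

theorem aux_iter_nonneg (k ν j : ℕ) : ∀ y ∈ Set.Icc (0 : ℝ) 1,
    0 ≤ ((bernsteinOp k)^[j] (bernsteinBasis k ν)) y := by
  induction j with
  | zero => exact fun y hy => aux_basis_nonneg k ν y hy
  | succ j ih =>
    intro y hy
    rw [Function.iterate_succ_apply']
    exact Finset.sum_nonneg fun μ hμ =>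
      mul_nonneg (ih _ (aux_node k μ hμ)) (aux_basis_nonneg k μ y hy)

theorem aux_iter_sum (k j : ℕ) : ∀ y : ℝ,
    ∑ ν ∈ Finset.range (k + 1), ((bernsteinOp k)^[j] (bernsteinBasis k ν)) y = 1 := by
  induction j with
  | zero => exact fun y => aux_basis_sum k y
  | succ j ih =>
    intro y
    simp only [Function.iterate_succ_apply']
    unfold bernsteinOp
    rw [Finset.sum_comm]
    simp only [← Finset.sum_mul]
    rw [← aux_basis_sum k y]
    refine Finset.sum_congr rfl fun μ _ => ?_
    have := ih ((μ : ℝ) / k)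
    unfold bernsteinOp at this
    rw [this, one_mul]

/-- For all positive integers `h, k` and every `y ∈ [0,1]`, the sum of absolute values of
the iterated Bernstein basis functions is bounded by `2^h - 1`. -/
theorem iterBernstein_abs_sum_le
    (h k : ℕ) (hh : 0 < h) (hk : 0 < k) (y : ℝ) (hy : y ∈ Set.Icc (0 : ℝ) 1) :
    ∑ ν ∈ Finset.range (k + 1), |iterBernsteinBasis h k ν y| ≤ 2 ^ h - 1 := by
  have h1 : ∀ ν ∈ Finset.range (k + 1), |iterBernsteinBasis h k ν y| ≤
      ∑ i ∈ Finset.Icc 1 h,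
        (h.choose i : ℝ) * ((bernsteinOp k)^[i - 1] (bernsteinBasis k ν)) y := by
    intro ν _
    unfold iterBernsteinBasis
    refine (Finset.abs_sum_le_sum_abs _ _).trans (Finset.sum_le_sum fun i _ => ?_)
    rw [abs_mul, abs_mul, abs_pow, abs_neg, abs_one, one_pow, mul_one, Nat.abs_cast,
      abs_of_nonneg (aux_iter_nonneg k ν (i - 1) y hy)]
  refine (Finset.sum_le_sum h1).trans ?_
  rw [Finset.sum_comm]
  simp only [← Finset.mul_sum, aux_iter_sum, mul_one]
  have h2 : ∑ i ∈ Finset.range (h + 1), (h.choose i : ℝ) = 2 ^ h := by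
    exact_mod_cast Nat.sum_range_choose h
  have h3 : Finset.range (h + 1) = insert 0 (Finset.Icc 1 h) := by
    ext i
    simp only [Finset.mem_range, Finset.mem_insert, Finset.mem_Icc]
    omega
  rw [h3, Finset.sum_insert (by simp)] at h2
  simp only [Nat.choose_zero_right, Nat.cast_one] at h2
  linarith
end

section
/- If f : [0,1] → ℝ is (γ,L)-Hölder continuous with 0 < γ ≤ 1 and L > 0, then for every positive integer k and every y ∈ [0,1], |f(y) − B_k(f; y)| ≤ L · (4k)^{−γ/2}. -/
open Finset

/-- If `f : [0,1] → ℝ` is `(γ,L)`-Hölder continuous with `0 < γ ≤ 1` and `L > 0`, then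
for every positive integer `k` and every `y ∈ [0,1]`,
`|f(y) − B_k(f; y)| ≤ L (4k)^{−γ/2}`. -/
theorem bernstein_approx_of_hoelder
    (γ L : ℝ) (hγ : 0 < γ) (hγ1 : γ ≤ 1) (hL : 0 < L) (f : ℝ → ℝ)
    (hf : ∀ x ∈ Set.Icc (0 : ℝ) 1, ∀ y ∈ Set.Icc (0 : ℝ) 1, |f x - f y| ≤ L * |x - y| ^ γ)
    (k : ℕ) (hk : 0 < k) (y : ℝ) (hy : y ∈ Set.Icc (0 : ℝ) 1) :
    |f y - bernsteinOp k f y| ≤ L * ((4 * k : ℝ)) ^ (-(γ / 2)) := by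
  obtain ⟨hy0, hy1⟩ := hy
  have hkR : (0 : ℝ) < k := by exact_mod_cast hk
  have hb0 : ∀ ν ∈ Finset.range (k + 1), 0 ≤ bernsteinBasis k ν y := by
    intro ν _
    have : 0 ≤ 1 - y := by linarith
    unfold bernsteinBasis
    positivity
  have hsum : ∑ ν ∈ Finset.range (k + 1), bernsteinBasis k ν y = 1 := by
    have h := congrArg (Polynomial.eval y) (bernsteinPolynomial.sum ℝ k)
    simpa [Polynomial.eval_finset_sum, bernsteinPolynomial, bernsteinBasis] using h
  have hvar : ∑ ν ∈ Finset.range (k + 1), bernsteinBasis k ν y * (y - (ν : ℝ) / k) ^ 2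
      = y * (1 - y) / k := by
    have h := congrArg (Polynomial.eval y) (bernsteinPolynomial.variance ℝ k)
    simp only [Polynomial.eval_finset_sum, bernsteinPolynomial, nsmul_eq_mul,
      Polynomial.eval_mul, Polynomial.eval_pow, Polynomial.eval_sub,
      Polynomial.eval_natCast, Polynomial.eval_X, Polynomial.eval_one] at h
    have h2 : ∑ ν ∈ Finset.range (k + 1), bernsteinBasis k ν y * (y - (ν : ℝ) / k) ^ 2
        = (k * y * (1 - y)) / (k : ℝ) ^ 2 := by
      rw [← h, Finset.sum_div]
      refine Finset.sum_congr rfl fun ν _ => ?_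
      unfold bernsteinBasis
      field_simp
    rw [h2]
    field_simp
  have hdiff : f y - bernsteinOp k f y
      = ∑ ν ∈ Finset.range (k + 1), (f y - f ((ν : ℝ) / k)) * bernsteinBasis k ν y := by
    simp only [sub_mul, Finset.sum_sub_distrib, ← Finset.mul_sum, hsum, mul_one, bernsteinOp]
  have hJ := (Real.concaveOn_rpow (p := γ / 2) (by linarith) (by linarith)).le_map_sum
    (t := Finset.range (k + 1)) (w := fun ν => bernsteinBasis k ν y)
    (p := fun ν : ℕ => (y - (ν : ℝ) / k) ^ 2) hb0 hsum
    (fun ν _ => Set.mem_Ici.mpr (sq_nonneg _))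
  simp only [smul_eq_mul] at hJ
  rw [hvar] at hJ
  have hpow : ∀ t : ℝ, |t| ^ γ = (t ^ 2) ^ (γ / 2) := by
    intro t
    rw [← sq_abs t, ← Real.rpow_natCast, ← Real.rpow_mul (abs_nonneg t)]
    congr 1
    push_cast
    ring
  calc |f y - bernsteinOp k f y|
      ≤ ∑ ν ∈ Finset.range (k + 1), |(f y - f ((ν : ℝ) / k)) * bernsteinBasis k ν y| := by
        rw [hdiff]
        exact Finset.abs_sum_le_sum_abs _ _
    _ ≤ ∑ ν ∈ Finset.range (k + 1),
          L * (bernsteinBasis k ν y * ((y - (ν : ℝ) / k) ^ 2) ^ (γ / 2)) := by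
        refine Finset.sum_le_sum fun ν hν => ?_
        have hνk : (ν : ℝ) ≤ k := by
          exact_mod_cast Nat.lt_succ_iff.mp (Finset.mem_range.mp hν)
        have h1 := hf y ⟨hy0, hy1⟩ ((ν : ℝ) / k)
          ⟨by positivity, (div_le_one hkR).mpr hνk⟩
        rw [hpow] at h1
        rw [abs_mul, abs_of_nonneg (hb0 ν hν)]
        have h2 := mul_le_mul_of_nonneg_right h1 (hb0 ν hν)
        linarith
    _ ≤ L * (y * (1 - y) / k) ^ (γ / 2) := by
        rw [← Finset.mul_sum]
        exact mul_le_mul_of_nonneg_left hJ hL.le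
    _ ≤ L * ((4 * k : ℝ)) ^ (-(γ / 2)) := by
        refine mul_le_mul_of_nonneg_left ?_ hL.le
        rw [Real.rpow_neg (by positivity), ← Real.inv_rpow (by positivity)]
        have h1y : 0 ≤ 1 - y := by linarith
        refine Real.rpow_le_rpow (by positivity) ?_ (by linarith)
        rw [mul_inv, div_eq_mul_inv]
        refine mul_le_mul_of_nonneg_right ?_ (by positivity)
        nlinarith [sq_nonneg (2 * y - 1)]
end

section
/- For every positive integer h there exists a constant D_h > 0, depending only on h, such that for every T > 0, every (2h,T)-smooth function f : [0,1] → ℝ, every positive integer k, and every y ∈ [0,1], |f(y) − B^{(h)}_k(f; y)| ≤ T · D_h · k^{−h}. -/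
open Finset

/-- The iterated Bernstein polynomial of order `h`:
`B^{(h)}_k(f; y) = ∑_{ν=0}^k f(ν/k) b^{(h)}_{ν,k}(y)`. -/
noncomputable def iterBernsteinOp (h k : ℕ) (f : ℝ → ℝ) (y : ℝ) : ℝ :=
  ∑ ν ∈ Finset.range (k + 1), f ((ν : ℝ) / (k : ℝ)) * iterBernsteinBasis h k ν y


/-- `f` has `n` successive derivatives on `[0,1]`, all bounded by `M`. -/
def Sm : ℕ → ℝ → (ℝ → ℝ) → Prop
  | 0, M, f => ∀ x ∈ (Set.Icc (0 : ℝ) 1), |f x| ≤ M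
  | n + 1, M, f => (∀ x ∈ (Set.Icc (0 : ℝ) 1), |f x| ≤ M) ∧
      ∃ f' : ℝ → ℝ, (∀ x ∈ (Set.Icc (0 : ℝ) 1), HasDerivWithinAt f (f' x) (Set.Icc (0 : ℝ) 1) x) ∧ Sm n M f'

lemma Sm.bound {n : ℕ} {M : ℝ} {f : ℝ → ℝ} (hf : Sm n M f) : ∀ x ∈ (Set.Icc (0 : ℝ) 1), |f x| ≤ M := by
  cases n with
  | zero => exact hf
  | succ n => exact hf.1

lemma Sm.pred {n : ℕ} {M : ℝ} {f : ℝ → ℝ} (hf : Sm (n + 1) M f) : Sm n M f := by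
  induction n generalizing f with
  | zero => exact hf.1
  | succ n ih =>
    obtain ⟨h1, f', h2, h3⟩ := hf
    exact ⟨h1, f', h2, ih h3⟩

lemma Sm.mono {n : ℕ} {M N : ℝ} {f : ℝ → ℝ} (hf : Sm n M f) (h : M ≤ N) : Sm n N f := by
  induction n generalizing f with
  | zero => exact fun x hx => (hf x hx).trans h
  | succ n ih =>
    obtain ⟨h1, f', h2, h3⟩ := hf
    exact ⟨fun x hx => (h1 x hx).trans h, f', h2, ih h3⟩

lemma Sm.add {n : ℕ} {M N : ℝ} {f g : ℝ → ℝ} (hf : Sm n M f) (hg : Sm n N g) :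
    Sm n (M + N) (fun x => f x + g x) := by
  induction n generalizing f g with
  | zero => exact fun x hx => (abs_add_le _ _).trans (add_le_add (hf x hx) (hg x hx))
  | succ n ih =>
    obtain ⟨h1, f', h2, h3⟩ := hf
    obtain ⟨k1, g', k2, k3⟩ := hg
    exact ⟨fun x hx => (abs_add_le _ _).trans (add_le_add (h1 x hx) (k1 x hx)),
      _, fun x hx => (h2 x hx).add (k2 x hx), ih h3 k3⟩

lemma Sm.smul {n : ℕ} {M : ℝ} {f : ℝ → ℝ} (c : ℝ) (hf : Sm n M f) :
    Sm n (|c| * M) (fun x => c * f x) := by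
  induction n generalizing f with
  | zero =>
    intro x hx
    rw [abs_mul]
    exact mul_le_mul_of_nonneg_left (hf x hx) (abs_nonneg _)
  | succ n ih =>
    obtain ⟨h1, f', h2, h3⟩ := hf
    refine ⟨fun x hx => ?_, _, fun x hx => (h2 x hx).const_mul c, ih h3⟩
    rw [abs_mul]
    exact mul_le_mul_of_nonneg_left (h1 x hx) (abs_nonneg _)

/-- The difference operator with `(B_{k+1} f)' = B_k (diffOp k f)`. -/
noncomputable def diffOp (k : ℕ) (f : ℝ → ℝ) (x : ℝ) : ℝ :=
  (k + 1) * (f ((k * x + 1) / (k + 1)) - f (k * x / (k + 1)))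

lemma mem_left {k : ℕ} {x : ℝ} (hx : x ∈ (Set.Icc (0 : ℝ) 1)) : (k * x / (k + 1) : ℝ) ∈ (Set.Icc (0 : ℝ) 1) := by
  have hk : (0 : ℝ) ≤ k := Nat.cast_nonneg k
  refine ⟨div_nonneg (mul_nonneg hk hx.1) (by linarith), ?_⟩
  rw [div_le_one (by linarith)]
  nlinarith [hx.2]

lemma mem_right {k : ℕ} {x : ℝ} (hx : x ∈ (Set.Icc (0 : ℝ) 1)) : ((k * x + 1) / (k + 1) : ℝ) ∈ (Set.Icc (0 : ℝ) 1) := by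
  have hk : (0 : ℝ) ≤ k := Nat.cast_nonneg k
  refine ⟨div_nonneg (add_nonneg (mul_nonneg hk hx.1) zero_le_one) (by linarith), ?_⟩
  rw [div_le_one (by linarith)]
  nlinarith [hx.2]

/-- mean value bound against an arbitrary linear slope -/
lemma mvt {f f' : ℝ → ℝ} (hf : ∀ x ∈ (Set.Icc (0 : ℝ) 1), HasDerivWithinAt f (f' x) (Set.Icc (0 : ℝ) 1) x)
    {a b c C : ℝ} (ha : a ∈ (Set.Icc (0 : ℝ) 1)) (hb : b ∈ (Set.Icc (0 : ℝ) 1)) (hC : ∀ s ∈ Set.uIcc a b, |f' s - c| ≤ C) :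
    |f b - f a - c * (b - a)| ≤ C * |b - a| := by
  have hsub : Set.uIcc a b ⊆ (Set.Icc (0 : ℝ) 1) := Set.uIcc_subset_Icc ha hb
  have := Convex.norm_image_sub_le_of_norm_hasDerivWithin_le (f := fun s => f s - c * s)
    (f' := fun s => f' s - c) (s := Set.uIcc a b) (C := C) (x := a) (y := b)
    (fun s hs => by
      have h1 := ((hf s (hsub hs)).mono hsub).sub (((hasDerivAt_id s).const_mul c).hasDerivWithinAt)
      exact h1.congr_deriv (by simp))
    (fun s hs => hC s hs) (convex_uIcc a b) Set.left_mem_uIcc Set.right_mem_uIcc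
  simp only [Real.norm_eq_abs] at this
  calc _ = |f b - c * b - (f a - c * a)| := by ring_nf
    _ ≤ _ := this

lemma diffOp_mvt {f f' : ℝ → ℝ} (hf : ∀ x ∈ (Set.Icc (0 : ℝ) 1), HasDerivWithinAt f (f' x) (Set.Icc (0 : ℝ) 1) x)
    (k : ℕ) {x c C : ℝ} (hx : x ∈ (Set.Icc (0 : ℝ) 1))
    (hC : ∀ s ∈ Set.Icc (k * x / (k + 1) : ℝ) ((k * x + 1) / (k + 1)), |f' s - c| ≤ C) :
    |diffOp k f x - c| ≤ C := by
  have hk : (0 : ℝ) < k + 1 := by positivity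
  have hle : (k * x / (k + 1) : ℝ) ≤ (k * x + 1) / (k + 1) := by gcongr; linarith
  have h1 := mvt hf (c := c) (C := C) (mem_left (k := k) hx) (mem_right (k := k) hx)
    (by rw [Set.uIcc_of_le hle]; exact hC)
  have h2 : ((k * x + 1) / (k + 1) - k * x / (k + 1) : ℝ) = 1 / (k + 1) := by ring
  rw [h2, abs_of_pos (by positivity : (0 : ℝ) < 1 / (k + 1))] at h1
  have h3 : diffOp k f x - c = (k + 1) * (f ((k * x + 1) / (k + 1)) - f (k * x / (k + 1)) -
      c * (1 / (k + 1))) := by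
    unfold diffOp; field_simp
  rw [h3, abs_mul, abs_of_pos hk]
  calc _ ≤ ((k : ℝ) + 1) * (C * (1 / (k + 1))) := mul_le_mul_of_nonneg_left h1 hk.le
    _ = C := by field_simp

lemma diffOp_deriv {f f' : ℝ → ℝ} (hf : ∀ x ∈ (Set.Icc (0 : ℝ) 1), HasDerivWithinAt f (f' x) (Set.Icc (0 : ℝ) 1) x)
    (k : ℕ) {x : ℝ} (hx : x ∈ (Set.Icc (0 : ℝ) 1)) :
    HasDerivWithinAt (diffOp k f) ((k / (k + 1)) * diffOp k f' x) (Set.Icc (0 : ℝ) 1) x := by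
  have e1 : HasDerivWithinAt (fun x : ℝ => (k * x + 1) / ((k : ℝ) + 1)) (k / (k + 1)) (Set.Icc (0 : ℝ) 1) x := by
    have := ((((hasDerivAt_id x).const_mul (k : ℝ)).add_const 1).div_const
      ((k : ℝ) + 1)).hasDerivWithinAt (s := (Set.Icc (0 : ℝ) 1))
    simpa using this
  have e2 : HasDerivWithinAt (fun x : ℝ => k * x / ((k : ℝ) + 1)) (k / (k + 1)) (Set.Icc (0 : ℝ) 1) x := by
    have := ((((hasDerivAt_id x).const_mul (k : ℝ))).div_const
      ((k : ℝ) + 1)).hasDerivWithinAt (s := (Set.Icc (0 : ℝ) 1))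
    simpa using this
  have h1 := (hf _ (mem_right (k := k) hx)).comp x e1 (fun y hy => mem_right hy)
  have h2 := (hf _ (mem_left (k := k) hx)).comp x e2 (fun y hy => mem_left hy)
  have h3 := (h1.sub h2).const_mul ((k : ℝ) + 1)
  refine (h3.congr_deriv ?_)
  unfold diffOp
  ring

lemma diffOp_Sm {j : ℕ} {k : ℕ} {T : ℝ} {f f' : ℝ → ℝ}
    (hf : ∀ x ∈ (Set.Icc (0 : ℝ) 1), HasDerivWithinAt f (f' x) (Set.Icc (0 : ℝ) 1) x) (hS : Sm j T f') :
    Sm j T (diffOp k f) := by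
  have hb : ∀ x ∈ (Set.Icc (0 : ℝ) 1), |diffOp k f x| ≤ T := by
    intro x hx
    have := diffOp_mvt hf k (c := 0) (C := T) hx (fun s hs => by
      rw [sub_zero]
      exact hS.bound s ⟨(mem_left hx).1.trans hs.1, hs.2.trans (mem_right hx).2⟩)
    simpa using this
  have hk : (0 : ℝ) < k + 1 := by positivity
  induction j generalizing f f' with
  | zero => exact hb
  | succ j ih =>
    obtain ⟨h1, f'', h2, h3⟩ := hS
    refine ⟨hb, _, fun x hx => diffOp_deriv hf k hx, ?_⟩
    have hb' : ∀ x ∈ (Set.Icc (0 : ℝ) 1), |diffOp k f' x| ≤ T := by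
      intro x hx
      have := diffOp_mvt h2 k (c := 0) (C := T) hx (fun s hs => by
        rw [sub_zero]
        exact h3.bound s ⟨(mem_left hx).1.trans hs.1, hs.2.trans (mem_right hx).2⟩)
      simpa using this
    have hT : 0 ≤ T := (abs_nonneg _).trans (h1 0 (by simp))
    refine ((ih h2 h3 hb').smul ((k : ℝ) / (k + 1))).mono ?_
    rw [abs_of_nonneg (by positivity)]
    have : (k : ℝ) / (k + 1) ≤ 1 := by rw [div_le_one hk]; linarith
    nlinarith

lemma diffOp_sub_Sm {j : ℕ} {k : ℕ} {T : ℝ} {f f' : ℝ → ℝ}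
    (hf : ∀ x ∈ (Set.Icc (0 : ℝ) 1), HasDerivWithinAt f (f' x) (Set.Icc (0 : ℝ) 1) x) (hS : Sm (j + 1) T f') :
    Sm j ((j + 1) * (T / (k + 1))) (fun x => diffOp k f x - f' x) := by
  have hk : (0 : ℝ) < k + 1 := by positivity
  have hT : 0 ≤ T := (abs_nonneg _).trans (hS.1 0 (by simp))
  induction j generalizing f f' with
  | zero =>
    obtain ⟨h1, f'', h2, h3⟩ := hS
    intro x hx
    simp only [CharP.cast_eq_zero, zero_add, one_mul]
    refine diffOp_mvt hf k hx fun s hs => ?_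
    have hs' : s ∈ (Set.Icc (0 : ℝ) 1) := ⟨(mem_left hx).1.trans hs.1, hs.2.trans (mem_right hx).2⟩
    have h4 := mvt h2 (c := 0) (C := T) hx hs' (fun t ht => by
      rw [sub_zero]; exact h3.bound t (Set.uIcc_subset_Icc hx hs' ht))
    rw [zero_mul, sub_zero] at h4
    refine h4.trans ?_
    rw [div_eq_mul_one_div]
    refine mul_le_mul_of_nonneg_left ?_ hT
    rw [abs_le]
    have e1 : (k * x / (k + 1) : ℝ) = x - x / (k + 1) := by field_simp; ring
    have e2 : ((k * x + 1) / (k + 1) : ℝ) = x + (1 - x) / (k + 1) := by field_simp; ring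
    have e3 : x / (k + 1) ≤ 1 / ((k : ℝ) + 1) := by gcongr; exact hx.2
    have e4 : (1 - x) / (k + 1) ≤ 1 / ((k : ℝ) + 1) := by gcongr; linarith [hx.1]
    have := hs.1
    have := hs.2
    constructor <;> linarith
  | succ j ih =>
    obtain ⟨h1, f'', h2, h3⟩ := hS
    have hval : ∀ x ∈ (Set.Icc (0 : ℝ) 1), |diffOp k f x - f' x| ≤ T / (k + 1) := by
      intro x hx
      refine diffOp_mvt hf k hx fun s hs => ?_
      have hs' : s ∈ (Set.Icc (0 : ℝ) 1) := ⟨(mem_left hx).1.trans hs.1, hs.2.trans (mem_right hx).2⟩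
      have h4 := mvt h2 (c := 0) (C := T) hx hs' (fun t ht => by
        rw [sub_zero]; exact h3.bound t (Set.uIcc_subset_Icc hx hs' ht))
      rw [zero_mul, sub_zero] at h4
      refine h4.trans ?_
      rw [div_eq_mul_one_div]
      refine mul_le_mul_of_nonneg_left ?_ hT
      rw [abs_le]
      have e1 : (k * x / (k + 1) : ℝ) = x - x / (k + 1) := by field_simp; ring
      have e2 : ((k * x + 1) / (k + 1) : ℝ) = x + (1 - x) / (k + 1) := by field_simp; ring
      have e3 : x / (k + 1) ≤ 1 / ((k : ℝ) + 1) := by gcongr; exact hx.2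
      have e4 : (1 - x) / (k + 1) ≤ 1 / ((k : ℝ) + 1) := by gcongr; linarith [hx.1]
      have := hs.1
      have := hs.2
      constructor <;> linarith
    have hq : 0 ≤ T / ((k : ℝ) + 1) := by positivity
    refine ⟨fun x hx => (hval x hx).trans ?_, _,
      fun x hx => (diffOp_deriv hf k hx).sub (h2 x hx), ?_⟩
    · push_cast
      have : (0 : ℝ) ≤ j := Nat.cast_nonneg j
      nlinarith
    · have a1 := ih h2 h3
      have a2 := (diffOp_Sm (k := k) h2 h3.pred).smul (-(1 / ((k : ℝ) + 1)))
      have a3 := a1.add a2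
      have e : (fun x => (k : ℝ) / (k + 1) * diffOp k f' x - f'' x) =
          fun x => (diffOp k f' x - f'' x) + -(1 / ((k : ℝ) + 1)) * diffOp k f' x := by
        funext x
        field_simp
        ring
      rw [e]
      refine a3.mono (le_of_eq ?_)
      rw [abs_neg, abs_of_pos (by positivity)]
      push_cast
      ring

lemma basis_eval (k ν : ℕ) (y : ℝ) :
    bernsteinBasis k ν y = (bernsteinPolynomial ℝ k ν).eval y := by
  simp [bernsteinBasis, bernsteinPolynomial]

lemma basis_sum (k : ℕ) (y : ℝ) : ∑ ν ∈ range (k + 1), bernsteinBasis k ν y = 1 := by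
  have := congrArg (Polynomial.eval y) (bernsteinPolynomial.sum ℝ k)
  simpa [Polynomial.eval_finsetSum, basis_eval] using this

lemma basis_mean (k : ℕ) (y : ℝ) : ∑ ν ∈ range (k + 1), (ν : ℝ) * bernsteinBasis k ν y = k * y := by
  have := congrArg (Polynomial.eval y) (bernsteinPolynomial.sum_smul ℝ k)
  simpa [Polynomial.eval_finsetSum, basis_eval] using this

lemma basis_var (k : ℕ) (y : ℝ) :
    ∑ ν ∈ range (k + 1), ((k : ℝ) * y - ν) ^ 2 * bernsteinBasis k ν y = k * y * (1 - y) := by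
  have := congrArg (Polynomial.eval y) (bernsteinPolynomial.variance ℝ k)
  simpa [Polynomial.eval_finsetSum, basis_eval] using this

lemma basis_nonneg (k ν : ℕ) {y : ℝ} (hy : y ∈ (Set.Icc (0 : ℝ) 1)) : 0 ≤ bernsteinBasis k ν y := by
  have h1 := hy.1
  have h2 : 0 ≤ 1 - y := by linarith [hy.2]
  unfold bernsteinBasis
  positivity

lemma bernsteinOp_deriv (k : ℕ) (f : ℝ → ℝ) (x : ℝ) :
    HasDerivAt (bernsteinOp (k + 1) f) (bernsteinOp k (diffOp k f) x) x := by
  have h1 : bernsteinOp (k + 1) f = fun y => (∑ ν ∈ range (k + 1 + 1),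
      Polynomial.C (f ((ν : ℝ) / ((k + 1 : ℕ) : ℝ))) * bernsteinPolynomial ℝ (k + 1) ν).eval y := by
    funext y
    simp [bernsteinOp, basis_eval, Polynomial.eval_finsetSum]
  rw [h1]
  refine (Polynomial.hasDerivAt _ x).congr_deriv ?_
  rw [Finset.sum_range_succ']
  simp only [Polynomial.derivative_add, Polynomial.derivative_sum, Polynomial.derivative_C_mul,
    bernsteinPolynomial.derivative_succ, bernsteinPolynomial.derivative_zero, Polynomial.eval_add,
    Polynomial.eval_finsetSum, Polynomial.eval_mul, Polynomial.eval_C, Polynomial.eval_sub,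
    Polynomial.eval_natCast, Polynomial.eval_neg, Nat.add_sub_cancel, ← basis_eval]
  have h0 : bernsteinBasis k (k + 1) x = 0 := by simp [bernsteinBasis]
  have key : ∑ i ∈ range (k + 1), f ((i : ℝ) / (k + 1)) * bernsteinBasis k i x =
      ∑ i ∈ range (k + 1), f (((i : ℝ) + 1) / (k + 1)) * bernsteinBasis k (i + 1) x +
        f 0 * bernsteinBasis k 0 x := by
    have a := Finset.sum_range_succ (fun i : ℕ => f ((i : ℝ) / (k + 1)) * bernsteinBasis k i x)
      (k + 1)
    have b := Finset.sum_range_succ' (fun i : ℕ => f ((i : ℝ) / (k + 1)) * bernsteinBasis k i x)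
      (k + 1)
    rw [a] at b
    simpa [h0] using b
  have e : bernsteinOp k (diffOp k f) x = (k + 1) *
      (∑ i ∈ range (k + 1), f (((i : ℝ) + 1) / (k + 1)) * bernsteinBasis k i x -
       ∑ i ∈ range (k + 1), f ((i : ℝ) / (k + 1)) * bernsteinBasis k i x) := by
    rw [← Finset.sum_sub_distrib, Finset.mul_sum]
    refine Finset.sum_congr rfl fun i hi => ?_
    have hki : (k : ℝ) * (i / k) = i := by
      rcases Nat.eq_zero_or_pos k with rfl | hk
      · have : i = 0 := by simpa using hi
        simp [this]
      · field_simp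
    simp only [diffOp, hki]
    ring
  rw [e, key]
  have e2 : ∑ i ∈ range (k + 1), f (((i + 1 : ℕ) : ℝ) / ((k + 1 : ℕ) : ℝ)) *
        (((k + 1 : ℕ) : ℝ) * (bernsteinBasis k i x - bernsteinBasis k (i + 1) x)) =
      (k + 1) * (∑ i ∈ range (k + 1), f (((i : ℝ) + 1) / (k + 1)) * bernsteinBasis k i x -
       ∑ i ∈ range (k + 1), f (((i : ℝ) + 1) / (k + 1)) * bernsteinBasis k (i + 1) x) := by
    rw [← Finset.sum_sub_distrib, Finset.mul_sum]
    refine Finset.sum_congr rfl fun i hi => ?_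
    push_cast
    ring
  rw [e2]
  simp
  ring

lemma base_bound {k : ℕ} {T : ℝ} {f : ℝ → ℝ} (hf : Sm 2 T f) {x : ℝ} (hx : x ∈ (Set.Icc (0 : ℝ) 1)) :
    |bernsteinOp k f x - f x| ≤ 2 * T / (k + 1) := by
  have hT : 0 ≤ T := (abs_nonneg _).trans (hf.1 0 (by simp))
  obtain ⟨h1, f', h2, h3, f'', h4, h5⟩ := hf
  rcases Nat.eq_zero_or_pos k with rfl | hk
  · have e : bernsteinOp 0 f x = f 0 := by simp [bernsteinOp, bernsteinBasis]
    rw [e]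
    have a := abs_le.1 (h1 0 (by simp))
    have b := abs_le.1 (h1 x hx)
    rw [abs_le]
    simp
    constructor <;> linarith
  have hk' : (0 : ℝ) < k := Nat.cast_pos.2 hk
  have tay : ∀ t ∈ (Set.Icc (0 : ℝ) 1), |f t - f x - f' x * (t - x)| ≤ T * (t - x) ^ 2 := by
    intro t ht
    have := mvt h2 (c := f' x) (C := T * |t - x|) hx ht (fun s hs => by
      have hs' := Set.uIcc_subset_Icc hx ht hs
      have h6 := mvt h4 (c := 0) (C := T) hx hs' (fun t ht => by
        rw [sub_zero]; exact h5 t (Set.uIcc_subset_Icc hx hs' ht))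
      rw [zero_mul, sub_zero] at h6
      refine h6.trans (mul_le_mul_of_nonneg_left ?_ hT)
      exact Set.abs_sub_left_of_mem_uIcc hs)
    rwa [mul_assoc, abs_mul_abs_self, ← sq] at this
  have e : bernsteinOp k f x - f x = ∑ ν ∈ range (k + 1),
      (f (ν / k) - f x - f' x * (ν / k - x)) * bernsteinBasis k ν x := by
    have a := basis_sum k x
    have b := basis_mean k x
    have : ∑ ν ∈ range (k + 1), (f (ν / k) - f x - f' x * (ν / k - x)) * bernsteinBasis k ν x
      = bernsteinOp k f x - f x * ∑ ν ∈ range (k + 1), bernsteinBasis k ν x -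
        f' x * ((∑ ν ∈ range (k + 1), (ν : ℝ) * bernsteinBasis k ν x) / k -
          x * ∑ ν ∈ range (k + 1), bernsteinBasis k ν x) := by
      unfold bernsteinOp
      rw [Finset.sum_div, Finset.mul_sum, Finset.mul_sum, ← Finset.sum_sub_distrib,
        ← Finset.sum_sub_distrib, Finset.mul_sum, ← Finset.sum_sub_distrib]
      refine Finset.sum_congr rfl fun i hi => ?_
      ring
    rw [this, a, b]
    field_simp
    ring
  rw [e]
  calc _ ≤ ∑ ν ∈ range (k + 1), |(f (ν / k) - f x - f' x * (ν / k - x)) * bernsteinBasis k ν x| :=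
        Finset.abs_sum_le_sum_abs _ _
    _ ≤ ∑ ν ∈ range (k + 1), T / k ^ 2 * (((k : ℝ) * x - ν) ^ 2 * bernsteinBasis k ν x) := by
        refine Finset.sum_le_sum fun ν hν => ?_
        have hm : (ν / k : ℝ) ∈ (Set.Icc (0 : ℝ) 1) := by
          refine ⟨by positivity, ?_⟩
          rw [div_le_one hk']
          exact_mod_cast Nat.lt_succ_iff.1 (Finset.mem_range.1 hν)
        rw [abs_mul, abs_of_nonneg (basis_nonneg k ν hx)]
        refine (mul_le_mul_of_nonneg_right (tay _ hm) (basis_nonneg k ν hx)).trans (le_of_eq ?_)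
        field_simp
        ring
    _ = T * (x * (1 - x)) / k := by
        rw [← Finset.mul_sum, basis_var]
        field_simp
    _ ≤ 2 * T / (k + 1) := by
        rw [div_le_div_iff₀ hk' (by positivity)]
        have hx1 : x * (1 - x) ≤ 1 := by nlinarith [hx.1, hx.2]
        have hk1 : (1 : ℝ) ≤ k := by exact_mod_cast hk
        have : T * (x * (1 - x)) ≤ T * 1 := mul_le_mul_of_nonneg_left hx1 hT
        nlinarith

lemma main_step (j : ℕ) : ∃ C : ℝ, 0 < C ∧ ∀ (k : ℕ) (T : ℝ) (f : ℝ → ℝ), Sm (j + 2) T f →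
    Sm j (C * T / (k + 1)) (fun x => bernsteinOp k f x - f x) := by
  induction j with
  | zero => exact ⟨2, by norm_num, fun k T f hf x hx => base_bound hf hx⟩
  | succ j ih =>
    obtain ⟨C, hC, ih⟩ := ih
    refine ⟨2 * C + 2 * j + 3, by positivity, fun k T f hf => ?_⟩
    have hT : 0 ≤ T := (abs_nonneg _).trans (hf.1 0 (by simp))
    have hf2 : Sm 2 T f := by
      obtain ⟨h1, f', h2, h3⟩ := hf
      obtain ⟨h4, f'', h5, h6⟩ := h3
      exact ⟨h1, f', h2, h4, f'', h5, h6.bound⟩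
    have hval : ∀ x ∈ (Set.Icc (0 : ℝ) 1), |bernsteinOp k f x - f x| ≤ (2 * C + 2 * j + 3) * T / (k + 1) := by
      intro x hx
      refine (base_bound hf2 hx).trans ?_
      have : (0 : ℝ) ≤ j := Nat.cast_nonneg j
      gcongr
      linarith
    obtain ⟨h1, f', h2, h3⟩ := hf
    cases k with
    | zero =>
      have e : bernsteinOp 0 f = fun _ => f 0 := by
        funext x; simp [bernsteinOp, bernsteinBasis]
      refine ⟨hval, fun x => (-1) * f' x, fun x hx => ?_, ?_⟩
      · rw [e]
        have := (h2 x hx).const_sub (f 0)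
        simpa using this
      · refine (h3.pred.pred.smul (-1)).mono ?_
        simp
        have : (0 : ℝ) ≤ j := Nat.cast_nonneg j
        have : 1 * T ≤ (2 * C + 2 * j + 3) * T := mul_le_mul_of_nonneg_right (by linarith) hT
        linarith
    | succ k =>
      refine ⟨hval, fun x => bernsteinOp k (diffOp k f) x - f' x,
        fun x hx => (bernsteinOp_deriv k f x).hasDerivWithinAt.sub (h2 x hx), ?_⟩
      have a1 := ih k T _ (diffOp_Sm (k := k) h2 h3)
      have a2 := diffOp_sub_Sm (k := k) h2 h3.pred
      have a3 := a1.add a2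
      have e : (fun x => bernsteinOp k (diffOp k f) x - f' x) =
          fun x => (bernsteinOp k (diffOp k f) x - diffOp k f x) + (diffOp k f x - f' x) := by
        funext x; ring
      rw [e]
      refine a3.mono ?_
      have hk : (0 : ℝ) ≤ k := Nat.cast_nonneg k
      have hj : (0 : ℝ) ≤ j := Nat.cast_nonneg j
      have e5 : C * T / (k + 1) + (j + 1) * (T / (k + 1)) = (C + j + 1) * T / ((k : ℝ) + 1) := by
        ring
      rw [e5, div_le_div_iff₀ (by positivity) (by positivity)]
      push_cast
      have e6 : 0 ≤ C * T := by positivity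
      have e7 : 0 ≤ j * T := by positivity
      nlinarith [mul_nonneg e6 hk, mul_nonneg e7 hk, mul_nonneg hT hk]

lemma iter_bound (h : ℕ) : ∃ D : ℝ, 0 < D ∧ ∀ (k : ℕ) (T : ℝ) (f : ℝ → ℝ), Sm (2 * h) T f →
    ∀ x ∈ (Set.Icc (0 : ℝ) 1), |((fun g : ℝ → ℝ => fun x => bernsteinOp k g x - g x)^[h] f) x| ≤
      T * D / (k + 1) ^ h := by
  induction h with
  | zero => exact ⟨1, one_pos, fun k T f hf x hx => by simpa using hf.bound x hx⟩
  | succ h ih =>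
    obtain ⟨D, hD, ih⟩ := ih
    obtain ⟨C, hC, hs⟩ := main_step (2 * h)
    refine ⟨C * D, by positivity, fun k T f hf x hx => ?_⟩
    rw [Function.iterate_succ_apply]
    refine (ih k _ _ (hs k T f hf) x hx).trans (le_of_eq ?_)
    rw [pow_succ]
    field_simp

/-- The Bernstein operator as a linear map. -/
noncomputable def bernsteinLin (k : ℕ) : Module.End ℝ (ℝ → ℝ) where
  toFun := bernsteinOp k
  map_add' f g := by
    funext y
    simp [bernsteinOp, add_mul, Finset.sum_add_distrib]
  map_smul' c f := by
    funext y
    simp [bernsteinOp, Finset.mul_sum, mul_assoc]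

lemma bernsteinLin_pow (k i : ℕ) (f : ℝ → ℝ) :
    (bernsteinLin k ^ i) f = (bernsteinOp k)^[i] f := by
  rw [Module.End.pow_apply]
  rfl

lemma one_sub_pow_aux {R : Type*} [Ring R] [Algebra ℝ R] (b : R) (h : ℕ) :
    (1 - b) ^ h = ∑ i ∈ range (h + 1), ((-1 : ℝ) ^ i * (h.choose i : ℝ)) • b ^ i := by
  have : (1 - b) = (-1 : ℝ) • b + 1 := by
    rw [neg_one_smul]; abel
  rw [this, (Commute.one_right _).add_pow]
  refine Finset.sum_congr rfl fun i _ => ?_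
  rw [smul_pow, one_pow, mul_one, mul_comm ((-1 : ℝ) ^ i), mul_smul, Nat.cast_smul_eq_nsmul,
    nsmul_eq_mul, Nat.cast_comm]

lemma one_sub_pow_neg {R : Type*} [Ring R] (b : R) (h : ℕ) :
    (1 - b) ^ h = (b - 1) ^ h ∨ (1 - b) ^ h = -(b - 1) ^ h := by
  rw [← neg_sub b 1, neg_pow]
  rcases neg_one_pow_eq_or R h with h' | h' <;> rw [h'] <;> simp

lemma iter_formula (h k : ℕ) (f : ℝ → ℝ) (y : ℝ) :
    f y - iterBernsteinOp h k f y = ((1 - bernsteinLin k) ^ h) f y := by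
  have e1 : iterBernsteinOp h k f y = ∑ i ∈ Finset.Icc 1 h,
      (h.choose i : ℝ) * (-1 : ℝ) ^ (i - 1) * ((bernsteinLin k ^ i) f) y := by
    unfold iterBernsteinOp iterBernsteinBasis
    simp_rw [Finset.mul_sum]
    rw [Finset.sum_comm]
    refine Finset.sum_congr rfl fun i hi => ?_
    obtain ⟨i, rfl⟩ := Nat.exists_eq_succ_of_ne_zero
      (Nat.one_le_iff_ne_zero.1 (Finset.mem_Icc.1 hi).1)
    have e2 : bernsteinLin k f = ∑ ν ∈ range (k + 1), f ((ν : ℝ) / k) • bernsteinBasis k ν := by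
      funext y
      simp [bernsteinLin, bernsteinOp]
    rw [Nat.succ_eq_add_one, pow_succ, Module.End.mul_apply, e2, map_sum, Finset.sum_apply,
      Finset.mul_sum]
    refine Finset.sum_congr rfl fun ν _ => ?_
    rw [map_smul, Pi.smul_apply, bernsteinLin_pow, smul_eq_mul, Nat.add_sub_cancel]
    ring
  have e3 : (1 - bernsteinLin k) ^ h = ∑ i ∈ range (h + 1),
      ((-1 : ℝ) ^ i * (h.choose i : ℝ)) • bernsteinLin k ^ i := one_sub_pow_aux _ h
  rw [e1, e3, LinearMap.sum_apply, Finset.sum_apply, Finset.sum_range_succ']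
  have e4 : Finset.Icc 1 h = Finset.Ico (0 + 1) (h + 1) := by
    ext i; simp only [Finset.mem_Icc, Finset.mem_Ico]; omega
  rw [e4, ← Finset.sum_Ico_add' _ 0 h 1, Nat.Ico_zero_eq_range]
  simp only [Nat.add_sub_cancel, LinearMap.smul_apply, Pi.smul_apply, smul_eq_mul, pow_zero,
    Module.End.one_apply, Nat.choose_zero_right, Nat.cast_one, one_mul]
  rw [sub_eq_add_neg, add_comm, ← Finset.sum_neg_distrib]
  congr 1
  refine Finset.sum_congr rfl fun i _ => ?_
  rw [pow_succ]
  ring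

lemma smooth_Sm {N : ℕ} {T : ℝ} {f : ℝ → ℝ} (hf : ContDiffOn ℝ N f (Set.Icc (0 : ℝ) 1))
    (hb : ∀ i ≤ N, ∀ y ∈ (Set.Icc (0 : ℝ) 1), |iteratedDerivWithin i f (Set.Icc (0 : ℝ) 1) y| ≤ T) (n m : ℕ) (hnm : m + n ≤ N) :
    Sm n T (iteratedDerivWithin m f (Set.Icc (0 : ℝ) 1)) := by
  induction n generalizing m with
  | zero => exact hb m (by omega)
  | succ n ih =>
    refine ⟨hb m (by omega), _, fun x hx => ?_, ih (m + 1) (by omega)⟩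
    rw [iteratedDerivWithin_succ]
    refine DifferentiableWithinAt.hasDerivWithinAt ?_
    exact hf.differentiableOn_iteratedDerivWithin (by exact_mod_cast (by omega : m < N))
      (uniqueDiffOn_Icc one_pos) x hx

/-- For every positive integer `h` there is a constant `D_h > 0` such that for every `T > 0`,
every `(2h,T)`-smooth `f : [0,1] → ℝ`, every positive integer `k` and every `y ∈ [0,1]`,
`|f(y) − B^{(h)}_k(f; y)| ≤ T D_h k^{−h}`. -/
theorem iterBernstein_approx_of_smooth (h : ℕ) (hh : 0 < h) :
    ∃ D : ℝ, 0 < D ∧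
      ∀ T : ℝ, 0 < T → ∀ f : ℝ → ℝ,
        ContDiffOn ℝ (2 * h) f (Set.Icc (0 : ℝ) 1) →
        (∀ i ≤ 2 * h, ∀ y ∈ Set.Icc (0 : ℝ) 1,
          |iteratedDerivWithin i f (Set.Icc (0 : ℝ) 1) y| ≤ T) →
        ∀ k : ℕ, 0 < k → ∀ y ∈ Set.Icc (0 : ℝ) 1,
          |f y - iterBernsteinOp h k f y| ≤ T * D / (k : ℝ) ^ h := by
  obtain ⟨D, hD, H⟩ := iter_bound h
  refine ⟨D, hD, fun T hT f hf hb k hk y hy => ?_⟩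
  have hS : Sm (2 * h) T f := by
    have := smooth_Sm (N := 2 * h) (by exact_mod_cast hf) hb (2 * h) 0 (by omega)
    rwa [iteratedDerivWithin_zero] at this
  have h1 := H k T f hS y hy
  have hk' : (0 : ℝ) < k := Nat.cast_pos.2 hk
  have e : |f y - iterBernsteinOp h k f y| =
      |((fun g : ℝ → ℝ => fun x => bernsteinOp k g x - g x)^[h] f) y| := by
    rw [iter_formula]
    have e1 : (fun g : ℝ → ℝ => fun x => bernsteinOp k g x - g x) =
        ⇑(bernsteinLin k - 1) := by
      funext g x
      rfl
    rw [e1, ← Module.End.pow_apply]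
    rcases one_sub_pow_neg (bernsteinLin k) h with h' | h' <;> rw [h']
    rw [LinearMap.neg_apply, Pi.neg_apply, abs_neg]
  rw [e]
  refine h1.trans ?_
  gcongr
  linarith
end

section
/- If f : [0,1]^ℓ → ℝ is (γ,L)-Hölder continuous with 0 < γ ≤ 1 and L > 0, then for every positive integer k and every y ∈ [0,1]^ℓ, the multivariate Bernstein polynomial satisfies |f(y) − B_k(f; y)| ≤ ℓ · L · (4k)^{−γ/2}. -/
open Finset

/-- The multivariate Bernstein polynomial of `f : [0,1]^ℓ → ℝ` of degree `k`:
`B_k(f; y) = ∑_{ν ∈ {0,…,k}^ℓ} f(ν/k) ∏_i b_{ν_i,k}(y_i)`. -/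
noncomputable def multiBernsteinOp (ℓ k : ℕ) (f : (Fin ℓ → ℝ) → ℝ) (y : Fin ℓ → ℝ) : ℝ :=
  ∑ ν : Fin ℓ → Fin (k + 1),
    f (fun i => ((ν i : ℕ) : ℝ) / (k : ℝ)) * ∏ i : Fin ℓ, bernsteinBasis k (ν i) (y i)

lemma bb_eq (k ν : ℕ) (y : unitInterval) : bernsteinBasis k ν y = bernstein k ν y := by
  rw [bernstein_apply]; rfl

lemma bb_nonneg (k ν : ℕ) (y : unitInterval) : 0 ≤ bernsteinBasis k ν y := by
  rw [bb_eq]; exact bernstein_nonneg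

lemma bb_sum (k : ℕ) (y : unitInterval) :
    ∑ m : Fin (k + 1), bernsteinBasis k m y = 1 := by
  simp only [bb_eq]; exact bernstein.probability k y

lemma bb_var (k : ℕ) (hk : 0 < k) (y : unitInterval) :
    ∑ m : Fin (k + 1), bernsteinBasis k m y * ((y : ℝ) - (m : ℕ) / (k : ℝ)) ^ 2 ≤ 1 / (4 * k) := by
  have h := bernstein.variance hk.ne' y
  have e : ∑ m : Fin (k + 1), bernsteinBasis k m y * ((y : ℝ) - (m : ℕ) / (k : ℝ)) ^ 2
      = (y : ℝ) * (1 - y) / k := by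
    rw [← h]
    refine Finset.sum_congr rfl fun m _ => ?_
    rw [bb_eq, mul_comm]; rfl
  rw [e]
  have hk' : (0 : ℝ) < k := by exact_mod_cast hk
  rw [div_le_div_iff₀ hk' (by positivity)]
  nlinarith [mul_nonneg hk'.le (sq_nonneg (2 * (y : ℝ) - 1))]

lemma bb_holder (k : ℕ) (hk : 0 < k) (γ : ℝ) (hγ : 0 < γ) (hγ1 : γ ≤ 1) (y : unitInterval) :
    ∑ m : Fin (k + 1), |(y : ℝ) - (m : ℕ) / (k : ℝ)| ^ γ * bernsteinBasis k m y
      ≤ (4 * k : ℝ) ^ (-(γ / 2)) := by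
  have hc := Real.concaveOn_rpow (p := γ / 2) (by positivity) (by linarith)
  have hj := hc.le_map_sum (t := Finset.univ) (w := fun m : Fin (k + 1) => bernsteinBasis k m y)
    (p := fun m : Fin (k + 1) => ((y : ℝ) - (m : ℕ) / (k : ℝ)) ^ 2)
    (fun m _ => bb_nonneg k m y) (bb_sum k y) (fun m _ => Set.mem_Ici.2 (sq_nonneg _))
  simp only [smul_eq_mul] at hj
  have hk' : (0 : ℝ) < k := by exact_mod_cast hk
  calc _ = ∑ m : Fin (k + 1), bernsteinBasis k m y *
        (((y : ℝ) - (m : ℕ) / (k : ℝ)) ^ 2) ^ (γ / 2) := by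
        refine Finset.sum_congr rfl fun m _ => ?_
        rw [mul_comm, ← sq_abs, ← Real.rpow_natCast, ← Real.rpow_mul (abs_nonneg _)]
        congr 2
        push_cast; ring
    _ ≤ _ := hj
    _ ≤ (1 / (4 * k : ℝ)) ^ (γ / 2) := by
        apply Real.rpow_le_rpow _ (bb_var k hk y) (by positivity)
        exact Finset.sum_nonneg fun m _ => mul_nonneg (bb_nonneg k m y) (sq_nonneg _)
    _ = _ := by
        rw [one_div, Real.inv_rpow (by positivity), Real.rpow_neg (by positivity)]

lemma marginal {ℓ k : ℕ} (b : Fin ℓ → Fin (k + 1) → ℝ) (hb : ∀ i, ∑ m, b i m = 1)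
    (i : Fin ℓ) (g : Fin (k + 1) → ℝ) :
    ∑ ν : Fin ℓ → Fin (k + 1), g (ν i) * ∏ j, b j (ν j) = ∑ m, g m * b i m := by
  have h := Fintype.prod_sum (fun (j : Fin ℓ) (m : Fin (k + 1)) => (if j = i then g m else 1) * b j m)
  simp only [Finset.prod_mul_distrib, Finset.prod_ite_eq', Finset.mem_univ, if_true] at h
  rw [← h, Finset.prod_eq_single i]
  · simp
  · intro j _ hj
    simp [hj, hb]
  · simp

lemma norm_rpow_le {ℓ : ℕ} (hℓ : 0 < ℓ) (x : Fin ℓ → ℝ) (γ : ℝ) (hγ : 0 < γ) :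
    ‖x‖ ^ γ ≤ ∑ i, |x i| ^ γ := by
  haveI : Nonempty (Fin ℓ) := ⟨⟨0, hℓ⟩⟩
  obtain ⟨i, hi⟩ := Finite.exists_max (fun i => ‖x i‖)
  have h1 : ‖x‖ ≤ |x i| := (pi_norm_le_iff_of_nonneg (abs_nonneg _)).2 hi
  calc _ ≤ |x i| ^ γ := Real.rpow_le_rpow (norm_nonneg _) h1 hγ.le
    _ ≤ _ := Finset.single_le_sum (f := fun i => |x i| ^ γ)
        (fun j _ => Real.rpow_nonneg (abs_nonneg _) _) (Finset.mem_univ i)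

/-- If `f : [0,1]^ℓ → ℝ` is `(γ,L)`-Hölder continuous (w.r.t. the sup norm) with
`0 < γ ≤ 1`, `L > 0`, then for every positive integer `k` and every `y ∈ [0,1]^ℓ`,
`|f(y) − B_k(f; y)| ≤ ℓ L (4k)^{−γ/2}`. -/
theorem multiBernstein_approx_of_hoelder
    (ℓ : ℕ) (hℓ : 0 < ℓ) (γ L : ℝ) (hγ : 0 < γ) (hγ1 : γ ≤ 1) (hL : 0 < L)
    (f : (Fin ℓ → ℝ) → ℝ)
    (hf : ∀ x ∈ Set.Icc (0 : Fin ℓ → ℝ) 1, ∀ y ∈ Set.Icc (0 : Fin ℓ → ℝ) 1,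
      |f x - f y| ≤ L * ‖x - y‖ ^ γ)
    (k : ℕ) (hk : 0 < k) (y : Fin ℓ → ℝ) (hy : y ∈ Set.Icc (0 : Fin ℓ → ℝ) 1) :
    |f y - multiBernsteinOp ℓ k f y| ≤ (ℓ : ℝ) * L * ((4 * k : ℝ)) ^ (-(γ / 2)) := by
  let z : Fin ℓ → unitInterval := fun i => ⟨y i, hy.1 i, hy.2 i⟩
  have hk' : (0 : ℝ) < k := by exact_mod_cast hk
  have hs : ∀ i, ∑ m : Fin (k + 1), bernsteinBasis k m (y i) = 1 := fun i => bb_sum k (z i)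
  have hw : ∀ ν : Fin ℓ → Fin (k + 1), 0 ≤ ∏ i, bernsteinBasis k (ν i) (y i) :=
    fun ν => Finset.prod_nonneg fun i _ => bb_nonneg k (ν i) (z i)
  have hw1 : ∑ ν : Fin ℓ → Fin (k + 1), ∏ i, bernsteinBasis k (ν i) (y i) = 1 := by
    have h := Fintype.prod_sum (fun (j : Fin ℓ) (m : Fin (k + 1)) => bernsteinBasis k m (y j))
    rw [← h]
    simp [hs]
  have e : f y - multiBernsteinOp ℓ k f y = ∑ ν : Fin ℓ → Fin (k + 1),
      (f y - f (fun i => ((ν i : ℕ) : ℝ) / (k : ℝ))) * ∏ i, bernsteinBasis k (ν i) (y i) := by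
    simp only [sub_mul, Finset.sum_sub_distrib, ← Finset.mul_sum, hw1, mul_one]
    rfl
  rw [e]
  calc _ ≤ ∑ ν : Fin ℓ → Fin (k + 1), |(f y - f (fun i => ((ν i : ℕ) : ℝ) / (k : ℝ))) *
        ∏ i, bernsteinBasis k (ν i) (y i)| := Finset.abs_sum_le_sum_abs _ _
    _ ≤ ∑ ν : Fin ℓ → Fin (k + 1), (L * ∑ i, |y i - ((ν i : ℕ) : ℝ) / (k : ℝ)| ^ γ) *
        ∏ i, bernsteinBasis k (ν i) (y i) := by
        refine Finset.sum_le_sum fun ν _ => ?_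
        rw [abs_mul, abs_of_nonneg (hw ν)]
        refine mul_le_mul_of_nonneg_right ?_ (hw ν)
        refine (hf y hy _ ⟨fun i => ?_, fun i => ?_⟩).trans
          (mul_le_mul_of_nonneg_left (norm_rpow_le hℓ _ γ hγ) hL.le)
        · simp only [Pi.zero_apply]; positivity
        · simp only [Pi.one_apply]
          rw [div_le_one hk']
          exact_mod_cast Nat.lt_succ_iff.1 (ν i).2
    _ = L * ∑ i, ∑ ν : Fin ℓ → Fin (k + 1), |y i - ((ν i : ℕ) : ℝ) / (k : ℝ)| ^ γ *
        ∏ j, bernsteinBasis k (ν j) (y j) := by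
        rw [Finset.sum_comm, Finset.mul_sum]
        refine Finset.sum_congr rfl fun ν _ => ?_
        rw [mul_assoc, Finset.sum_mul]
    _ ≤ L * ∑ i : Fin ℓ, (4 * k : ℝ) ^ (-(γ / 2)) := by
        refine mul_le_mul_of_nonneg_left (Finset.sum_le_sum fun i _ => ?_) hL.le
        rw [marginal (fun i m => bernsteinBasis k m (y i)) hs i
          (fun m => |y i - ((m : ℕ) : ℝ) / (k : ℝ)| ^ γ)]
        exact bb_holder k hk γ hγ hγ1 (z i)
    _ = _ := by
        simp only [Finset.sum_const, Finset.card_univ, Fintype.card_fin, nsmul_eq_mul]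
        ring
end

section
/- Let f : ℝ → [0,∞) be a log-concave probability density with f(y) = f(−y) for all y ∈ ℝ, and let Z_1, …, Z_m be i.i.d. real random variables with density f. Suppose a = (a_1, …, a_m) and b = (b_1, …, b_m) in [0,1]^m satisfy: (i) a_1 ≥ a_2 ≥ … ≥ a_m and b_1 ≥ b_2 ≥ … ≥ b_m; (ii) ∑_{i=1}^{j} b_i ≤ ∑_{i=1}^{j} a_i for all j = 1, …, m−1; (iii) ∑_{i=1}^{m} a_i = ∑_{i=1}^{m} b_i = 1. Then for every τ ≥ 0, Pr[|∑_{i=1}^{m} b_i Z_i| ≥ τ] ≤ Pr[|∑_{i=1}^{m} a_i Z_i| ≥ τ]. -/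
open MeasureTheory Finset

def SymDec (g : ℝ → ENNReal) : Prop := ∀ x y : ℝ, |x| ≤ |y| → g y ≤ g x

lemma SymDec.measurable {g : ℝ → ENNReal} (hg : SymDec g) : Measurable g := by
  have h1 : Antitone (fun t : ℝ => g (max t 0)) := by
    intro s t hst
    apply hg
    rw [abs_of_nonneg (le_max_right _ _), abs_of_nonneg (le_max_right _ _)]
    exact max_le_max_right 0 hst
  have h2 : g = (fun t : ℝ => g (max t 0)) ∘ (fun x : ℝ => |x|) := by
    funext x
    simp only [Function.comp]
    rw [max_eq_left (abs_nonneg x)]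
    exact le_antisymm (hg _ _ (by simp)) (hg _ _ (by simp))
  rw [h2]
  exact h1.measurable.comp measurable_norm

lemma SymDec.neg {g : ℝ → ENNReal} (hg : SymDec g) (x : ℝ) : g (-x) = g x :=
  le_antisymm (hg _ _ (by simp)) (hg _ _ (by simp))

lemma rearr {a b x y : ENNReal} (hab : a ≤ b) (hxy : x ≤ y) :
    a * y + b * x ≤ b * y + a * x := by
  obtain ⟨d, rfl⟩ := exists_add_of_le hab
  calc a * y + (a + d) * x = a * x + a * y + d * x := by ring
    _ ≤ a * x + a * y + d * y := by gcongr
    _ = _ := by ring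

/-- convolution with a symmetric decreasing density -/
lemma SymDec.conv {g φ : ℝ → ENNReal} (hg : SymDec g) (hφ : SymDec φ) (c : ℝ) :
    SymDec (fun x => ∫⁻ z, g (x + c * z) ∂(volume.withDensity φ)) := by
  have hgm := hg.measurable
  have hφm := hφ.measurable
  intro x y hxy
  simp only
  by_cases hc : c = 0
  · subst hc
    simp only [zero_mul, add_zero]
    exact lintegral_mono fun _ => hg _ _ hxy
  rw [lintegral_withDensity_eq_lintegral_mul _ hφm (by fun_prop),
    lintegral_withDensity_eq_lintegral_mul _ hφm (by fun_prop)]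
  simp only [Pi.mul_apply]
  obtain ⟨e, he⟩ : ∃ e, y = x + c * e := ⟨(y - x) / c, by field_simp; ring⟩
  have X2 : ∫⁻ z, φ z * g (x + c * z) = ∫⁻ z, φ (z - e) * g (y - c * z) := by
    rw [← lintegral_sub_left_eq_self (fun z => φ z * g (x + c * z)) e]
    refine lintegral_congr fun z => ?_
    rw [← hφ.neg (z - e), he]; ring_nf
  have Y1 : ∫⁻ z, φ z * g (y + c * z) = ∫⁻ z, φ (z - e) * g (x + c * z) := by
    rw [← lintegral_sub_right_eq_self (fun z => φ z * g (y + c * z)) e]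
    refine lintegral_congr fun z => ?_
    rw [he]; ring_nf
  have Y2 : ∫⁻ z, φ z * g (y + c * z) = ∫⁻ z, φ z * g (y - c * z) := by
    rw [← lintegral_neg_eq_self]
    refine lintegral_congr fun z => ?_
    rw [hφ.neg]; ring_nf
  have key : (∫⁻ z, φ z * g (y + c * z)) + (∫⁻ z, φ z * g (y + c * z)) ≤
      (∫⁻ z, φ z * g (x + c * z)) + (∫⁻ z, φ z * g (x + c * z)) := by
    nth_rewrite 1 [Y1]
    rw [Y2]
    nth_rewrite 2 [X2]
    rw [← lintegral_add_left (by fun_prop), ← lintegral_add_left (by fun_prop)]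
    refine lintegral_mono fun z => ?_
    have hsq : x ^ 2 ≤ y ^ 2 := sq_le_sq.2 hxy
    have hprod : 0 ≤ (y + x) * e * c := by rw [he] at hsq ⊢; nlinarith
    have hor : (|x + c * z| ≤ |y - c * z| ∧ |z| ≤ |z - e|) ∨
        (|y - c * z| ≤ |x + c * z| ∧ |z - e| ≤ |z|) := by
      simp only [← sq_le_sq]
      have e1 : (y - c * z) ^ 2 - (x + c * z) ^ 2 = (y + x) * c * (e - 2 * z) := by
        rw [he]; ring
      have e2 : (z - e) ^ 2 - z ^ 2 = e * (e - 2 * z) := by ring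
      have hP : 0 ≤ ((y + x) * c) * e := by linarith
      generalize (y + x) * c = q at e1 hP
      generalize e - 2 * z = w at e1 e2
      rcases lt_trichotomy e 0 with he0 | he0 | he0
      · have hq : q ≤ 0 := by by_contra hq; push Not at hq; nlinarith
        rcases le_total w 0 with hw | hw
        · left; constructor <;> nlinarith
        · right; constructor <;> nlinarith
      · have e3 : (z - e) ^ 2 = z ^ 2 := by rw [he0]; ring
        rw [e3]
        rcases le_total ((x + c * z) ^ 2) ((y - c * z) ^ 2) with h | h
        · exact Or.inl ⟨h, le_rfl⟩
        · exact Or.inr ⟨h, le_rfl⟩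
      · have hq : 0 ≤ q := by by_contra hq; push Not at hq; nlinarith
        rcases le_total w 0 with hw | hw
        · right; constructor <;> nlinarith
        · left; constructor <;> nlinarith
    rcases hor with ⟨h1, h2⟩ | ⟨h1, h2⟩
    · exact rearr (hφ _ _ h2) (hg _ _ h1)
    · have := rearr (hφ _ _ h2) (hg _ _ h1)
      rwa [add_comm, add_comm (φ z * g (x + c * z))]
  rw [← two_mul, ← two_mul] at key
  exact (ENNReal.mul_le_mul_iff_right (by simp) (by simp)).1 key

lemma four_point {f : ℝ → ℝ} (hf0 : ∀ x, 0 ≤ f x)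
    (hlc : ∀ x y : ℝ, ∀ t ∈ Set.Icc (0 : ℝ) 1,
      f x ^ t * f y ^ (1 - t) ≤ f (t * x + (1 - t) * y))
    (A B t : ℝ) (ht : t ∈ Set.Icc (0 : ℝ) 1) :
    f A * f B ≤ f (t * A + (1 - t) * B) * f (t * B + (1 - t) * A) := by
  have h1 := hlc A B t ht
  have h2 := hlc B A t ht
  have h1t : 0 ≤ 1 - t := by linarith [ht.2]
  have e : ∀ x, f x = f x ^ t * f x ^ (1 - t) := fun x => by
    rw [← Real.rpow_add_of_nonneg (hf0 x) ht.1 h1t]; simp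
  calc f A * f B = (f A ^ t * f B ^ (1 - t)) * (f B ^ t * f A ^ (1 - t)) := by
        nth_rewrite 1 [e A, e B]; ring
    _ ≤ _ := mul_le_mul h1 h2 (mul_nonneg (Real.rpow_nonneg (hf0 _) _) (Real.rpow_nonneg (hf0 _) _)) (hf0 _)

lemma symDec_of_logconcave {f : ℝ → ℝ} (hf0 : ∀ x, 0 ≤ f x) (hfsym : ∀ x, f (-x) = f x)
    (hlc : ∀ x y : ℝ, ∀ t ∈ Set.Icc (0 : ℝ) 1,
      f x ^ t * f y ^ (1 - t) ≤ f (t * x + (1 - t) * y)) :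
    SymDec (fun x => ENNReal.ofReal (f x)) := by
  intro x y hxy
  apply ENNReal.ofReal_le_ofReal
  by_cases hy : y = 0
  · have : x = 0 := by subst hy; simpa using hxy
    rw [hy, this]
  have hxy' : |x / y| ≤ 1 := by
    rw [abs_div]; exact div_le_one_of_le₀ hxy (abs_nonneg _)
  rw [abs_le] at hxy'
  have h := hlc y (-y) ((1 + x / y) / 2) ⟨by linarith, by linarith⟩
  have e : (1 + x / y) / 2 * y + (1 - (1 + x / y) / 2) * -y = x := by field_simp; ring
  rw [e, hfsym, ← Real.rpow_add_of_nonneg (hf0 y) (by linarith) (by linarith)] at h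
  simpa using h

lemma refl_ineq {f : ℝ → ℝ} (hf0 : ∀ x, 0 ≤ f x) (hfsym : ∀ x, f (-x) = f x)
    (hlc : ∀ x y : ℝ, ∀ t ∈ Set.Icc (0 : ℝ) 1,
      f x ^ t * f y ^ (1 - t) ≤ f (t * x + (1 - t) * y))
    (p ξ η : ℝ) (hp : 0 ≤ p) (h2 : ξ + η ≤ 0) (h1 : η ≤ ξ) :
    f (p - ξ) * f (p - η) ≤ f (p + ξ) * f (p + η) := by
  by_cases h0 : 2 * p - η - ξ = 0
  · have : p = 0 := by linarith
    subst this
    simp [hfsym]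
  have hpos : 0 < 2 * p - η - ξ := lt_of_le_of_ne (by linarith) (Ne.symm h0)
  have := four_point hf0 hlc (ξ - p) (p - η) ((- η - ξ) / (2 * p - η - ξ))
    ⟨div_nonneg (by linarith) hpos.le, (div_le_one hpos).2 (by linarith)⟩
  have e1 : (- η - ξ) / (2 * p - η - ξ) * (ξ - p) + (1 - (- η - ξ) / (2 * p - η - ξ)) * (p - η)
    = ξ + p := by field_simp; ring
  have e2 : (- η - ξ) / (2 * p - η - ξ) * (p - η) + (1 - (- η - ξ) / (2 * p - η - ξ)) * (ξ - p)
    = -(p + η) := by field_simp; ring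
  rw [e1, e2, hfsym, ← hfsym (ξ - p), neg_sub, add_comm ξ p] at this
  exact this

/-- lines are null -/
lemma line_null (a b t : ℝ) (ha : a ≠ 0) :
    ∀ᵐ z : ℝ × ℝ, a * z.1 + b * z.2 ≠ t := by
  have hm : MeasurableSet {z : ℝ × ℝ | a * z.1 + b * z.2 ≠ t} :=
    (measurableSet_eq_fun (by fun_prop) (by fun_prop)).compl
  rw [Measure.volume_eq_prod, ae_iff]
  have hm2 : MeasurableSet {z : ℝ × ℝ | ¬ (a * z.1 + b * z.2 ≠ t)} := hm.compl
  rw [Measure.prod_apply_symm hm2]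
  refine lintegral_eq_zero_of_ae_eq_zero (Filter.Eventually.of_forall fun y => ?_)
  refine measure_mono_null (t := {(t - b * y) / a}) ?_ (by simp)
  intro x hx
  have hx' : a * x + b * y = t := by simpa using hx
  rw [Set.mem_singleton_iff, ← hx']
  field_simp
  ring

lemma halfplane {φ : ℝ → ENNReal} (hφm : Measurable φ)
    (hR : ∀ p ξ η : ℝ, 0 ≤ p → ξ + η ≤ 0 → η ≤ ξ →
      φ (p - ξ) * φ (p - η) ≤ φ (p + ξ) * φ (p + η))
    (a b a' b' t : ℝ) (hs : a + b = a' + b') (h1 : b' ≤ a') (h2 : a' < a) (hb : 0 ≤ b)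
    (ht : 0 ≤ t) :
    ((volume.withDensity φ).prod (volume.withDensity φ)) {z | t ≤ a' * z.1 + b' * z.2} ≤
    ((volume.withDensity φ).prod (volume.withDensity φ)) {z | t < a * z.1 + b * z.2} := by
  have hspos : 0 < a + b := by linarith
  have hm' : MeasurableSet {z : ℝ × ℝ | t ≤ a' * z.1 + b' * z.2} :=
    measurableSet_le (by fun_prop) (by fun_prop)
  have hm : MeasurableSet {z : ℝ × ℝ | t < a * z.1 + b * z.2} :=
    measurableSet_lt (by fun_prop) (by fun_prop)
  rw [prod_withDensity hφm hφm, withDensity_apply _ hm', withDensity_apply _ hm,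
    ← lintegral_indicator hm', ← lintegral_indicator hm, ← Measure.volume_eq_prod]
  obtain ⟨p, hp⟩ : ∃ p, t = (a + b) * p := ⟨t / (a + b), by field_simp⟩
  have hp0 : 0 ≤ p := by
    by_contra h; push Not at h; nlinarith
  set F : ℝ × ℝ → ENNReal := fun z => φ z.1 * φ z.2 with hF
  have hFm : Measurable F := by fun_prop
  set R : ℝ × ℝ := (2 * p, 2 * p) with hRdef
  have refl : ∀ G : ℝ × ℝ → ENNReal, ∫⁻ z, G (R - z) = ∫⁻ z, G z := fun G =>
    lintegral_sub_left_eq_self G R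
  have key : (∫⁻ z, Set.indicator {z : ℝ × ℝ | t ≤ a' * z.1 + b' * z.2} F z) +
      (∫⁻ z, Set.indicator {z : ℝ × ℝ | t ≤ a' * z.1 + b' * z.2} F z) ≤
      (∫⁻ z, Set.indicator {z : ℝ × ℝ | t < a * z.1 + b * z.2} F z) +
      (∫⁻ z, Set.indicator {z : ℝ × ℝ | t < a * z.1 + b * z.2} F z) := by
    nth_rewrite 2 [← refl]
    nth_rewrite 4 [← refl]
    rw [← lintegral_add_left (hFm.indicator hm'), ← lintegral_add_left (hFm.indicator hm)]
    refine lintegral_mono_ae ?_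
    filter_upwards [line_null a b t (by linarith), line_null a' b' t (by linarith)] with z hz hz'
    have hu : a * (R - z).1 + b * (R - z).2 = 2 * t - (a * z.1 + b * z.2) := by
      simp only [hRdef, Prod.fst_sub, Prod.snd_sub]; rw [hp]; ring
    have hu' : a' * (R - z).1 + b' * (R - z).2 = 2 * t - (a' * z.1 + b' * z.2) := by
      simp only [hRdef, Prod.fst_sub, Prod.snd_sub]; rw [hp, hs]; ring
    simp only [Set.indicator, Set.mem_ofPred_eq, hu, hu']
    have hdiff : (a * z.1 + b * z.2) - (a' * z.1 + b' * z.2) = (a - a') * (z.1 - z.2) := by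
      have : b' = a + b - a' := by linarith
      rw [this]; ring
    have haa : 0 < a - a' := by linarith
    have hF1 : a * z.1 + b * z.2 < t → t < a' * z.1 + b' * z.2 → F z ≤ F (R - z) := by
      intro g1 g2
      have hδ : z.1 < z.2 := by
        by_contra h; push Not at h; nlinarith
      have hσ : 0 ≤ z.1 + z.2 - 2 * p := by
        by_contra h; push Not at h; nlinarith
      have := hR p (p - z.1) (p - z.2) hp0 (by linarith) (by linarith)
      simp only [hF, hRdef, Prod.fst_sub, Prod.snd_sub]
      convert this using 3 <;> ring
    have hF2 : a' * z.1 + b' * z.2 < t → t < a * z.1 + b * z.2 → F (R - z) ≤ F z := by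
      intro g1 g2
      have hδ : z.2 < z.1 := by
        by_contra h; push Not at h; nlinarith
      have hσ : z.1 + z.2 - 2 * p ≤ 0 := by
        by_contra h; push Not at h; nlinarith
      have := hR p (z.1 - p) (z.2 - p) hp0 (by linarith) (by linarith)
      simp only [hF, hRdef, Prod.fst_sub, Prod.snd_sub]
      convert this using 3 <;> ring
    rcases lt_or_gt_of_ne hz with g | g <;> rcases lt_or_gt_of_ne hz' with g' | g'
    · rw [if_neg (by linarith), if_pos (by linarith), if_neg (by linarith), if_pos (by linarith)]
    · rw [if_pos (by linarith), if_neg (by linarith), if_neg (by linarith), if_pos (by linarith)]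
      simpa using hF1 g g'
    · rw [if_neg (by linarith), if_pos (by linarith), if_pos (by linarith), if_neg (by linarith)]
      simpa using hF2 g' g
    · rw [if_pos (by linarith), if_neg (by linarith), if_pos (by linarith), if_neg (by linarith)]
  rw [← two_mul, ← two_mul] at key
  exact (ENNReal.mul_le_mul_iff_right (by simp) (by simp)).1 key

lemma prod_symm_set {φ : ℝ → ENNReal} (hφ : SymDec φ) (S : Set (ℝ × ℝ)) (hS : MeasurableSet S) :
    ((volume.withDensity φ).prod (volume.withDensity φ)) {z | -z ∈ S} =
    ((volume.withDensity φ).prod (volume.withDensity φ)) S := by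
  have hφm := hφ.measurable
  have hS' : MeasurableSet {z : ℝ × ℝ | -z ∈ S} := measurable_neg hS
  rw [prod_withDensity hφm hφm, withDensity_apply _ hS', withDensity_apply _ hS,
    ← lintegral_indicator hS', ← lintegral_indicator hS, ← Measure.volume_eq_prod,
    ← lintegral_neg_eq_self]
  refine lintegral_congr fun z => ?_
  have hiff : (-z ∈ {z : ℝ × ℝ | -z ∈ S}) ↔ z ∈ S := by
    rw [Set.mem_ofPred_eq, neg_neg]
  by_cases hz : z ∈ S
  · rw [Set.indicator_of_mem (hiff.2 hz), Set.indicator_of_mem hz]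
    simp only [Prod.fst_neg, Prod.snd_neg, hφ.neg]
  · rw [Set.indicator_of_notMem (fun h => hz (hiff.1 h)), Set.indicator_of_notMem hz]

lemma two_sided {φ : ℝ → ENNReal} (hφ : SymDec φ)
    (hR : ∀ p ξ η : ℝ, 0 ≤ p → ξ + η ≤ 0 → η ≤ ξ →
      φ (p - ξ) * φ (p - η) ≤ φ (p + ξ) * φ (p + η))
    (a b a' b' t : ℝ) (hs : a + b = a' + b') (h1 : b' ≤ a') (h2 : a' < a) (hb : 0 ≤ b)
    (ht : 0 ≤ t) :
    ((volume.withDensity φ).prod (volume.withDensity φ)) {z | t ≤ |a' * z.1 + b' * z.2|} ≤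
    ((volume.withDensity φ).prod (volume.withDensity φ)) {z | t < |a * z.1 + b * z.2|} := by
  have hm' : MeasurableSet {z : ℝ × ℝ | t ≤ a' * z.1 + b' * z.2} :=
    measurableSet_le (by fun_prop) (by fun_prop)
  have hm : MeasurableSet {z : ℝ × ℝ | t < a * z.1 + b * z.2} :=
    measurableSet_lt (by fun_prop) (by fun_prop)
  have e1 : {z : ℝ × ℝ | t ≤ |a' * z.1 + b' * z.2|} =
      {z | t ≤ a' * z.1 + b' * z.2} ∪ {z | -z ∈ {z : ℝ × ℝ | t ≤ a' * z.1 + b' * z.2}} := by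
    ext z
    simp only [Set.mem_ofPred_eq, Set.mem_union, le_abs, Prod.fst_neg, Prod.snd_neg]
    ring_nf
  have e2 : {z : ℝ × ℝ | t < |a * z.1 + b * z.2|} =
      {z | t < a * z.1 + b * z.2} ∪ {z | -z ∈ {z : ℝ × ℝ | t < a * z.1 + b * z.2}} := by
    ext z
    simp only [Set.mem_ofPred_eq, Set.mem_union, lt_abs, Prod.fst_neg, Prod.snd_neg]
    ring_nf
  have hd : Disjoint {z : ℝ × ℝ | t < a * z.1 + b * z.2}
      {z | -z ∈ {z : ℝ × ℝ | t < a * z.1 + b * z.2}} := by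
    rw [Set.disjoint_left]
    intro z hz hz'
    simp only [Set.mem_ofPred_eq, Prod.fst_neg, Prod.snd_neg] at hz hz'
    linarith
  have hh := halfplane hφ.measurable hR a b a' b' t hs h1 h2 hb ht
  rw [e1, e2, measure_union hd (measurable_neg hm), prod_symm_set hφ _ hm]
  refine (measure_union_le _ _).trans ?_
  rw [prod_symm_set hφ _ hm']
  gcongr

lemma pair_ineq {φ : ℝ → ENNReal} (hφ : SymDec φ) (hφ1 : ∫⁻ x, φ x = 1)
    (hR : ∀ p ξ η : ℝ, 0 ≤ p → ξ + η ≤ 0 → η ≤ ξ →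
      φ (p - ξ) * φ (p - η) ≤ φ (p + ξ) * φ (p + η))
    (a b a' b' : ℝ) (hs : a + b = a' + b') (h1 : b' ≤ a') (h2 : a' < a) (hb : 0 ≤ b)
    {g : ℝ → ENNReal} (hg : SymDec g) (hgtop : ∀ x, g x ≠ ⊤) :
    ∫⁻ x, ∫⁻ y, g (a * x + b * y) ∂(volume.withDensity φ) ∂(volume.withDensity φ) ≤
    ∫⁻ x, ∫⁻ y, g (a' * x + b' * y) ∂(volume.withDensity φ) ∂(volume.withDensity φ) := by
  have hgm := hg.measurable
  set ν := volume.withDensity φ with hν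
  have : IsProbabilityMeasure ν := ⟨by rw [hν, withDensity_apply _ MeasurableSet.univ]; simpa⟩
  rw [← lintegral_prod (fun z : ℝ × ℝ => g (a * z.1 + b * z.2)) (by fun_prop),
    ← lintegral_prod (fun z : ℝ × ℝ => g (a' * z.1 + b' * z.2)) (by fun_prop)]
  have hof : ∀ x, g x = ENNReal.ofReal (g x).toReal := fun x => (ENNReal.ofReal_toReal (hgtop x)).symm
  rw [lintegral_congr (fun z : ℝ × ℝ => hof (a * z.1 + b * z.2)),
    lintegral_congr (fun z : ℝ × ℝ => hof (a' * z.1 + b' * z.2)),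
    lintegral_eq_lintegral_meas_lt _ (Filter.Eventually.of_forall fun _ => ENNReal.toReal_nonneg)
      (by fun_prop),
    lintegral_eq_lintegral_meas_lt _ (Filter.Eventually.of_forall fun _ => ENNReal.toReal_nonneg)
      (by fun_prop)]
  refine lintegral_mono fun l => ?_
  set S : Set ℝ := {u | l < (g u).toReal} with hS
  have hSdown : ∀ u v, |u| ≤ |v| → v ∈ S → u ∈ S := by
    intro u v huv hv
    exact lt_of_lt_of_le hv (ENNReal.toReal_mono (hgtop u) (hg u v huv))
  change (ν.prod ν) {z | a * z.1 + b * z.2 ∈ S} ≤ (ν.prod ν) {z | a' * z.1 + b' * z.2 ∈ S}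
  by_cases hall : ∀ v, v ∈ S
  · exact measure_mono fun z _ => hall _
  push Not at hall
  obtain ⟨v, hv⟩ := hall
  rcases S.eq_empty_or_nonempty with hemp | hne
  · simp [hemp]
  have hbdd : BddAbove (abs '' S) := by
    refine ⟨|v|, ?_⟩
    rintro _ ⟨u, hu, rfl⟩
    by_contra h
    push Not at h
    exact hv (hSdown v u h.le hu)
  set r := sSup (abs '' S) with hr
  have hle : ∀ u ∈ S, |u| ≤ r := fun u hu => le_csSup hbdd ⟨u, hu, rfl⟩
  have hlt : ∀ u, |u| < r → u ∈ S := by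
    intro u hu
    obtain ⟨_, ⟨w, hw, rfl⟩, huw⟩ := exists_lt_of_lt_csSup (hne.image _) hu
    exact hSdown u w huw.le hw
  have hr0 : 0 ≤ r := by
    obtain ⟨w, hw⟩ := hne
    exact (abs_nonneg w).trans (hle w hw)
  have h2s := two_sided hφ hR a b a' b' r hs h1 h2 hb hr0
  rw [← hν] at h2s
  have hm' : MeasurableSet {z : ℝ × ℝ | r ≤ |a' * z.1 + b' * z.2|} :=
    measurableSet_le (by fun_prop) (by fun_prop)
  have hm : MeasurableSet {z : ℝ × ℝ | r < |a * z.1 + b * z.2|} :=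
    measurableSet_lt (by fun_prop) (by fun_prop)
  calc (ν.prod ν) {z | a * z.1 + b * z.2 ∈ S}
      ≤ (ν.prod ν) {z : ℝ × ℝ | r < |a * z.1 + b * z.2|}ᶜ :=
        measure_mono fun z hz => by simpa using hle _ hz
    _ = 1 - (ν.prod ν) {z : ℝ × ℝ | r < |a * z.1 + b * z.2|} := prob_compl_eq_one_sub hm
    _ ≤ 1 - (ν.prod ν) {z : ℝ × ℝ | r ≤ |a' * z.1 + b' * z.2|} := by gcongr
    _ = (ν.prod ν) {z : ℝ × ℝ | r ≤ |a' * z.1 + b' * z.2|}ᶜ := (prob_compl_eq_one_sub hm').symm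
    _ ≤ _ := measure_mono fun z hz => hlt _ (by simpa using hz)

lemma marginal_form {ι : Type*} [Fintype ι] [DecidableEq ι] {φ : ℝ → ENNReal} (hφ : SymDec φ)
    (hφ1 : ∫⁻ x, φ x = 1) {g : ℝ → ENNReal} (hg : SymDec g) (hg1 : ∀ x, g x ≤ 1)
    (a : ι → ℝ) (s : Finset ι) :
    ∃ h : ℝ → ENNReal, SymDec h ∧ (∀ x, h x ≤ 1) ∧
      ∀ a' : ι → ℝ, (∀ i ∈ s, a' i = a i) → ∀ z : ι → ℝ,
        lmarginal (fun _ : ι => volume.withDensity φ) s (fun z => g (∑ i, a' i * z i)) z =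
          h (∑ i ∈ sᶜ, a' i * z i) := by
  have hgm := hg.measurable
  set ν := volume.withDensity φ with hν
  have : IsProbabilityMeasure ν := ⟨by rw [hν, withDensity_apply _ MeasurableSet.univ]; simpa⟩
  induction s using Finset.induction_on with
  | empty => exact ⟨g, hg, hg1, fun a' _ z => by simp⟩
  | insert i s hi ih =>
    obtain ⟨h, hh, hh1, hrep⟩ := ih
    refine ⟨fun x => ∫⁻ z, h (x + a i * z) ∂ν, hh.conv hφ (a i), ?_, ?_⟩
    · intro x
      calc ∫⁻ z, h (x + a i * z) ∂ν ≤ ∫⁻ z, 1 ∂ν := lintegral_mono fun z => hh1 _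
        _ = 1 := by simp
    · intro a' ha' z
      rw [lmarginal_insert _ (by fun_prop) hi]
      refine lintegral_congr fun x => ?_
      rw [hrep a' (fun j hj => ha' j (mem_insert_of_mem hj))]
      congr 1
      have hc : sᶜ = insert i (insert i s)ᶜ := by
        ext j; simp only [mem_compl, mem_insert]
        by_cases hj : j = i
        · subst hj; simp [hi]
        · simp [hj]
      rw [hc, sum_insert (by simp), add_comm, ha' i (mem_insert_self i s)]
      congr 1
      · refine sum_congr rfl fun j hj => ?_
        rw [Function.update_of_ne]
        rintro rfl; simp at hj
      · simp

lemma transfer {ι : Type*} [Fintype ι] [DecidableEq ι] {φ : ℝ → ENNReal} (hφ : SymDec φ)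
    (hφ1 : ∫⁻ x, φ x = 1)
    (hR : ∀ p ξ η : ℝ, 0 ≤ p → ξ + η ≤ 0 → η ≤ ξ →
      φ (p - ξ) * φ (p - η) ≤ φ (p + ξ) * φ (p + η))
    {g : ℝ → ENNReal} (hg : SymDec g) (hg1 : ∀ x, g x ≤ 1)
    (a a' : ι → ℝ) (j k : ι) (hjk : j ≠ k) (haa : ∀ i, i ≠ j → i ≠ k → a' i = a i)
    (hs : a j + a k = a' j + a' k) (h1 : a' k ≤ a' j) (h2 : a' j < a j) (hb : 0 ≤ a k) :
    ∫⁻ z, g (∑ i, a i * z i) ∂(Measure.pi fun _ : ι => volume.withDensity φ) ≤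
    ∫⁻ z, g (∑ i, a' i * z i) ∂(Measure.pi fun _ : ι => volume.withDensity φ) := by
  have hgm := hg.measurable
  obtain ⟨h, hh, hh1, hrep⟩ := marginal_form hφ hφ1 hg hg1 a ({j, k} : Finset ι)ᶜ
  set ν := volume.withDensity φ with hν
  have : IsProbabilityMeasure ν := ⟨by rw [hν, withDensity_apply _ MeasurableSet.univ]; simpa⟩
  have form : ∀ c : ι → ℝ, (∀ i, i ≠ j → i ≠ k → c i = a i) →
      ∫⁻ z, g (∑ i, c i * z i) ∂(Measure.pi fun _ : ι => ν) =
        ∫⁻ x, ∫⁻ y, h (c j * x + c k * y) ∂ν ∂ν := by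
    intro c hc
    rw [lintegral_eq_lmarginal_univ (fun _ => (0 : ℝ))]
    have hu : (univ : Finset ι) = insert j (insert k ({j, k} : Finset ι)ᶜ) := by
      ext i; simp; tauto
    have hfm : Measurable (fun z : ι → ℝ => g (∑ i, c i * z i)) := by fun_prop
    have hrep' := hrep c (fun i hi => hc i (by simp at hi; tauto) (by simp at hi; tauto))
    generalize (fun z : ι → ℝ => g (∑ i, c i * z i)) = G at hfm hrep' ⊢
    rw [hu, lmarginal_insert _ hfm (by simp [hjk])]
    refine lintegral_congr fun x => ?_
    rw [lmarginal_insert _ hfm (by simp)]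
    refine lintegral_congr fun y => ?_
    rw [hrep']
    rw [compl_compl, sum_pair hjk]
    simp [Function.update_of_ne hjk]
  rw [form a (fun _ _ _ => rfl), form a' haa]
  exact pair_ineq hφ hφ1 hR _ _ _ _ hs h1 h2 hb hh (fun x => ne_top_of_le_ne_top (by simp) (hh1 x))

lemma majorization_step {m : ℕ} {φ : ℝ → ENNReal} (hφ : SymDec φ)
    (hφ1 : ∫⁻ x, φ x = 1)
    (hR : ∀ p ξ η : ℝ, 0 ≤ p → ξ + η ≤ 0 → η ≤ ξ →
      φ (p - ξ) * φ (p - η) ≤ φ (p + ξ) * φ (p + η))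
    {g : ℝ → ENNReal} (hg : SymDec g) (hg1 : ∀ x, g x ≤ 1)
    (b : Fin m → ℝ) (hb0 : ∀ i, 0 ≤ b i)
    (hb_mono : ∀ i j : Fin m, i ≤ j → b j ≤ b i) (n : ℕ) :
    ∀ a : Fin m → ℝ, (∀ i, 0 ≤ a i) →
    (∀ j : Fin m,
      ∑ i ∈ Finset.univ.filter (· ≤ j), b i ≤ ∑ i ∈ Finset.univ.filter (· ≤ j), a i) →
    ∑ i, a i = ∑ i, b i → (univ.filter fun i => a i ≠ b i).card ≤ n →
    ∫⁻ z, g (∑ i, a i * z i) ∂(Measure.pi fun _ : Fin m => volume.withDensity φ) ≤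
    ∫⁻ z, g (∑ i, b i * z i) ∂(Measure.pi fun _ : Fin m => volume.withDensity φ) := by
  induction n with
  | zero =>
    intro a _ _ _ hcard
    have : a = b := by
      funext i
      by_contra h
      have : i ∈ (univ.filter fun i => a i ≠ b i) := by simp [h]
      rw [Finset.card_eq_zero.1 (Nat.le_zero.1 hcard)] at this
      simp at this
    rw [this]
  | succ n ih =>
    intro a ha0 hmaj hsum hcard
    by_cases hab : ∀ i, b i ≤ a i
    · have : a = b := by
        funext i
        exact ((Finset.sum_eq_sum_iff_of_le (fun i _ => hab i)).1 hsum.symm i (mem_univ i)).symm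
      rw [this]
    push Not at hab
    obtain ⟨k, hk, hkmin⟩ : ∃ k, a k < b k ∧ ∀ i, i < k → b i ≤ a i := by
      have hne : (univ.filter fun i => a i < b i).Nonempty := by
        obtain ⟨i, hi⟩ := hab
        exact ⟨i, by simpa using hi⟩
      refine ⟨(univ.filter fun i => a i < b i).min' hne, ?_, ?_⟩
      · have := min'_mem _ hne
        simpa using this
      · intro i hi
        by_contra h
        push Not at h
        exact absurd (min'_le (univ.filter fun i => a i < b i) i (by simpa using h)) (not_le.2 hi)
    obtain ⟨j, hjk, hj⟩ : ∃ j, j < k ∧ b j < a j := by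
      by_contra hcon
      push Not at hcon
      have := hmaj k
      refine absurd this (not_le.2 ?_)
      apply Finset.sum_lt_sum
      · intro i hi
        rcases lt_or_eq_of_le (by simpa using hi : i ≤ k) with h | h
        · exact hcon i h
        · rw [h]; exact hk.le
      · exact ⟨k, by simp, hk⟩
    set δ := min (a j - b j) (b k - a k) with hδ
    have hδ0 : 0 < δ := lt_min (by linarith) (by linarith)
    have hδ1 : δ ≤ a j - b j := min_le_left _ _
    have hδ2 : δ ≤ b k - a k := min_le_right _ _
    have hbjk := hb_mono j k hjk.le
    set a' : Fin m → ℝ := fun i => a i + (if i = j then -δ else 0) + (if i = k then δ else 0)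
      with ha'
    have ha'j : a' j = a j - δ := by simp [ha', hjk.ne]; ring
    have ha'k : a' k = a k + δ := by simp [ha', hjk.ne']
    have ha'o : ∀ i, i ≠ j → i ≠ k → a' i = a i := by
      intro i h1 h2; simp [ha', h1, h2]
    refine (transfer hφ hφ1 hR hg hg1 a a' j k hjk.ne ha'o ?_ ?_ ?_ (ha0 k)).trans (ih a' ?_ ?_ ?_ ?_)
    · rw [ha'j, ha'k]; ring
    · rw [ha'j, ha'k]; linarith
    · rw [ha'j]; linarith
    · intro i
      by_cases h1 : i = j
      · rw [h1, ha'j]; linarith [hb0 j]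
      by_cases h2 : i = k
      · rw [h2, ha'k]; linarith [ha0 k]
      rw [ha'o i h1 h2]; exact ha0 i
    · intro l
      have hsplit : ∑ i ∈ univ.filter (· ≤ l), a' i = ∑ i ∈ univ.filter (· ≤ l), a i +
          (if j ≤ l then -δ else 0) + (if k ≤ l then δ else 0) := by
        simp only [ha', sum_add_distrib, sum_ite_eq', mem_filter, mem_univ, true_and]
      rw [hsplit]
      by_cases hkl : k ≤ l
      · rw [if_pos hkl, if_pos (hjk.le.trans hkl)]
        linarith [hmaj l]
      rw [if_neg hkl]
      by_cases hjl : j ≤ l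
      · rw [if_pos hjl]
        push Not at hkl
        have hmem : j ∈ univ.filter (· ≤ l) := by simpa using hjl
        rw [← add_sum_erase _ _ hmem, ← add_sum_erase _ a hmem]
        have : ∑ i ∈ (univ.filter (· ≤ l)).erase j, b i ≤
            ∑ i ∈ (univ.filter (· ≤ l)).erase j, a i := by
          refine sum_le_sum fun i hi => hkmin i ?_
          simp only [mem_erase, mem_filter, mem_univ, true_and] at hi
          exact hi.2.trans_lt hkl
        linarith
      · rw [if_neg hjl]
        linarith [hmaj l]
    · rw [← hsum]
      simp [ha', sum_add_distrib]
    · have hlt : (univ.filter fun i => a' i ≠ b i).card < (univ.filter fun i => a i ≠ b i).card := by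
        apply card_lt_card
        rw [ssubset_iff_of_subset]
        · rcases min_choice (a j - b j) (b k - a k) with h | h
          · refine ⟨j, by simpa using hj.ne', ?_⟩
            simp only [mem_filter, mem_univ, true_and, not_not]
            rw [ha'j, hδ, h]; ring
          · refine ⟨k, by simpa using hk.ne, ?_⟩
            simp only [mem_filter, mem_univ, true_and, not_not]
            rw [ha'k, hδ, h]; ring
        · intro i hi
          simp only [mem_filter, mem_univ, true_and] at hi ⊢
          by_cases h1 : i = j
          · rw [h1]; exact hj.ne'
          by_cases h2 : i = k
          · rw [h2]; exact hk.ne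
          rwa [ha'o i h1 h2] at hi
      omega

/-- **Proschan's theorem.** Let `f : ℝ → [0,∞)` be a symmetric log-concave probability
density, and let `Z_1, …, Z_m` be i.i.d. with density `f`. If `a, b ∈ [0,1]^m` are
nonincreasing, `b` is majorized by `a` (partial sums of `b` are dominated by those of `a`),
and both sum to `1`, then for every `τ ≥ 0`,
`Pr[|∑ b_i Z_i| ≥ τ] ≤ Pr[|∑ a_i Z_i| ≥ τ]`. -/
theorem proschan_peakedness
    (m : ℕ) (hm : 0 < m) (f : ℝ → ℝ)
    (hf0 : ∀ x, 0 ≤ f x)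
    (hfsym : ∀ x, f (-x) = f x)
    (hflogconcave : ∀ x y : ℝ, ∀ t ∈ Set.Icc (0 : ℝ) 1,
      f x ^ t * f y ^ (1 - t) ≤ f (t * x + (1 - t) * y))
    (hfdens : ∫ x, f x = 1)
    {Ω : Type*} [MeasurableSpace Ω] (μ : Measure Ω) (Z : Fin m → Ω → ℝ)
    (hZ : μ.map (fun ω => fun i => Z i ω) =
      Measure.pi (fun _ : Fin m => volume.withDensity (fun x => ENNReal.ofReal (f x))))
    (a b : Fin m → ℝ)
    (ha01 : ∀ i, a i ∈ Set.Icc (0 : ℝ) 1) (hb01 : ∀ i, b i ∈ Set.Icc (0 : ℝ) 1)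
    (ha_mono : ∀ i j : Fin m, i ≤ j → a j ≤ a i)
    (hb_mono : ∀ i j : Fin m, i ≤ j → b j ≤ b i)
    (hmaj : ∀ j : Fin m,
      ∑ i ∈ Finset.univ.filter (· ≤ j), b i ≤ ∑ i ∈ Finset.univ.filter (· ≤ j), a i)
    (ha_sum : ∑ i, a i = 1) (hb_sum : ∑ i, b i = 1)
    (τ : ℝ) (hτ : 0 ≤ τ) :
    μ {ω | τ ≤ |∑ i, b i * Z i ω|} ≤ μ {ω | τ ≤ |∑ i, a i * Z i ω|} := by
  
  have hsd := symDec_of_logconcave hf0 hfsym hflogconcave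
  have hint : Integrable f := by
    by_contra h
    rw [integral_undef h] at hfdens
    exact zero_ne_one hfdens
  have hφ1 : ∫⁻ x, ENNReal.ofReal (f x) = 1 := by
    rw [← ofReal_integral_eq_lintegral_ofReal hint (Filter.Eventually.of_forall hf0), hfdens]
    simp
  have hR : ∀ p ξ η : ℝ, 0 ≤ p → ξ + η ≤ 0 → η ≤ ξ →
      ENNReal.ofReal (f (p - ξ)) * ENNReal.ofReal (f (p - η)) ≤
      ENNReal.ofReal (f (p + ξ)) * ENNReal.ofReal (f (p + η)) := by
    intro p ξ η hp h1 h2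
    rw [← ENNReal.ofReal_mul (hf0 _), ← ENNReal.ofReal_mul (hf0 _)]
    exact ENNReal.ofReal_le_ofReal (refl_ineq hf0 hfsym hflogconcave p ξ η hp h1 h2)
  have hmajor := fun g hg hg1 => majorization_step (g := g) hsd hφ1 hR hg hg1 b
    (fun i => (hb01 i).1) hb_mono _ a (fun i => (ha01 i).1) hmaj (ha_sum.trans hb_sum.symm) le_rfl
  set ν := volume.withDensity (fun x => ENNReal.ofReal (f x)) with hν
  have : IsProbabilityMeasure ν := ⟨by rw [hν, withDensity_apply _ MeasurableSet.univ]; simpa⟩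
  have hae : AEMeasurable (fun ω => fun i => Z i ω) μ := by
    by_contra h
    rw [Measure.map_of_not_aemeasurable h] at hZ
    exact IsProbabilityMeasure.ne_zero (Measure.pi fun _ : Fin m => ν) hZ.symm
  have hmeas : ∀ c : Fin m → ℝ, MeasurableSet {z : Fin m → ℝ | τ ≤ |∑ i, c i * z i|} := fun c =>
    measurableSet_le (by fun_prop) (by fun_prop)
  have hmeas' : ∀ c : Fin m → ℝ, MeasurableSet {z : Fin m → ℝ | |∑ i, c i * z i| < τ} := fun c =>
    measurableSet_lt (by fun_prop) (by fun_prop)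
  have hform : ∀ c : Fin m → ℝ, μ {ω | τ ≤ |∑ i, c i * Z i ω|} =
      1 - (Measure.pi fun _ : Fin m => ν) {z | |∑ i, c i * z i| < τ} := by
    intro c
    rw [← prob_compl_eq_one_sub (hmeas' c)]
    have : {z : Fin m → ℝ | |∑ i, c i * z i| < τ}ᶜ = {z | τ ≤ |∑ i, c i * z i|} := by
      ext z; simp
    rw [this, ← hZ, Measure.map_apply_of_aemeasurable hae (hmeas c)]
    rfl
  rw [hform a, hform b]
  have hfin := hmajor (Set.indicator {u | |u| < τ} 1) ?_ ?_
  · have hI : ∀ c : Fin m → ℝ, ∫⁻ z, Set.indicator {u : ℝ | |u| < τ} 1 (∑ i, c i * z i)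
        ∂(Measure.pi fun _ : Fin m => ν) =
        (Measure.pi fun _ : Fin m => ν) {z | |∑ i, c i * z i| < τ} := by
      intro c
      rw [← lintegral_indicator_one (hmeas' c)]
      rfl
    rw [hI, hI] at hfin
    gcongr
  · intro x y hxy
    simp only [Set.indicator, Set.mem_ofPred_eq]
    split_ifs with h1 h2
    · exact le_rfl
    · exact absurd (hxy.trans_lt h1) h2
    · simp
    · simp
  · intro x
    simp only [Set.indicator]
    split_ifs <;> simp
end

section
/- Let X be a set, n and d positive integers, ε > 0, and let f : X^n → ℝ^d have finite positive sensitivity S(f). Let M be the mechanism that on input D ∈ X^n outputs f(D) + Z, where Z ∈ ℝ^d has i.i.d. coordinates distributed as Lap(S(f)/ε), i.e., M(D) is the pushforward of the d-fold product Laplace measure under translation by f(D). Then M provides ε-differential privacy: for every pair D, D' ∈ X^n differing in one entry and every Borel set S ⊆ ℝ^d, Pr[M(D) ∈ S] ≤ e^ε · Pr[M(D') ∈ S]. -/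
open MeasureTheory Finset

/-- The Laplace distribution `Lap(λ)` on `ℝ`, with density `x ↦ exp(−|x|/λ)/(2λ)`
with respect to Lebesgue measure. -/
noncomputable def laplaceMeasure (l : ℝ) : Measure ℝ :=
  volume.withDensity fun x => ENNReal.ofReal (Real.exp (-|x| / l) / (2 * l))

/-- Two databases `D, D' ∈ X^n` are neighbors if they differ in (at most) one entry. -/
def Neighboring {X : Type*} {n : ℕ} (D D' : Fin n → X) : Prop :=
  ∃ i : Fin n, ∀ j : Fin n, j ≠ i → D j = D' j

lemma laplace_map_apply (l a : ℝ) {s : Set ℝ} (hs : MeasurableSet s) :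
    (Measure.map (fun z => a + z) (laplaceMeasure l)) s =
      ∫⁻ y in s, ENNReal.ofReal (Real.exp (-|y - a| / l) / (2 * l)) := by
  have hm : Measurable (fun z : ℝ => a + z) := by fun_prop
  rw [Measure.map_apply hm hs, laplaceMeasure, withDensity_apply _ (hm hs)]
  have h := (measurePreserving_add_left (volume : Measure ℝ) a).setLIntegral_comp_preimage
    (f := fun y => ENNReal.ofReal (Real.exp (-|y - a| / l) / (2 * l))) hs (by fun_prop)
  rw [← h]
  simp

lemma laplace_map_le (l a b : ℝ) (hl : 0 < l) :
    Measure.map (fun z => a + z) (laplaceMeasure l) ≤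
      ENNReal.ofReal (Real.exp (|a - b| / l)) •
        Measure.map (fun z => b + z) (laplaceMeasure l) := by
  refine Measure.le_iff.2 fun s hs => ?_
  rw [Measure.smul_apply, laplace_map_apply l a hs, laplace_map_apply l b hs, smul_eq_mul,
    ← lintegral_const_mul _ (by fun_prop)]
  refine lintegral_mono fun y => ?_
  rw [← ENNReal.ofReal_mul (Real.exp_pos _).le]
  apply ENNReal.ofReal_le_ofReal
  rw [← mul_div_assoc, ← Real.exp_add, ← add_div]
  have : |y - b| ≤ |y - a| + |a - b| := abs_sub_le y a b
  gcongr
  linarith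

instance laplace_sigmaFinite (l : ℝ) : SigmaFinite (laplaceMeasure l) := by
  unfold laplaceMeasure
  exact SigmaFinite.withDensity_ofReal _

instance laplace_map_sigmaFinite (l a : ℝ) :
    SigmaFinite (Measure.map (fun z => a + z) (laplaceMeasure l)) :=
  (MeasurableEquiv.addLeft a).sigmaFinite_map

lemma pi_le_smul {d : ℕ} (μ ν : Fin d → Measure ℝ) [∀ i, SigmaFinite (μ i)]
    (c : Fin d → ENNReal) (K : ENNReal) (hK0 : K ≠ 0) (hK : K ≠ ⊤)
    (hc : ∏ i, c i ≤ K) (h : ∀ i, μ i ≤ c i • ν i) {s : Set (Fin d → ℝ)}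
    (hs : MeasurableSet s) :
    Measure.pi μ s ≤ K * Measure.pi ν s := by
  have key : K⁻¹ • (Measure.pi μ).toOuterMeasure ≤
      OuterMeasure.pi fun i => (ν i).toOuterMeasure := by
    rw [OuterMeasure.le_pi]
    intro t _
    change K⁻¹ * Measure.pi μ (Set.univ.pi t) ≤ ∏ i, ν i (t i)
    rw [Measure.pi_pi, ENNReal.inv_mul_le_iff hK0 hK]
    calc ∏ i, μ i (t i) ≤ ∏ i, (c i * ν i (t i)) :=
          Finset.prod_le_prod' fun i _ => h i (t i)
      _ = (∏ i, c i) * ∏ i, ν i (t i) := Finset.prod_mul_distrib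
      _ ≤ _ := by gcongr
  have h1 : K⁻¹ * Measure.pi μ s ≤ (OuterMeasure.pi fun i => (ν i).toOuterMeasure) s := key s
  have h2 : Measure.pi ν s = (OuterMeasure.pi fun i => (ν i).toOuterMeasure) s := by
    rw [Measure.pi, toMeasure_apply _ _ hs]
  rw [← ENNReal.inv_mul_le_iff hK0 hK, h2]
  exact h1

/-- **The Laplace mechanism is ε-differentially private.** If `f : X^n → ℝ^d` has
sensitivity (ℓ¹, over neighboring databases) at most `S`, then the mechanism
`D ↦ f(D) + Z`, with `Z` having i.i.d. `Lap(S/ε)` coordinates, satisfies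
`Pr[M(D) ∈ s] ≤ e^ε Pr[M(D') ∈ s]` for all neighboring `D, D'` and Borel `s`. -/
theorem laplace_mechanism_dp
    {X : Type*} (n d : ℕ) (hn : 0 < n) (hd : 0 < d) (ε : ℝ) (hε : 0 < ε)
    (f : (Fin n → X) → (Fin d → ℝ)) (S : ℝ) (hS : 0 < S)
    (hsens : ∀ D D' : Fin n → X, Neighboring D D' → ∑ i : Fin d, |f D i - f D' i| ≤ S) :
    ∀ D D' : Fin n → X, Neighboring D D' →
      ∀ s : Set (Fin d → ℝ), MeasurableSet s →
        (Measure.map (fun z => f D + z) (Measure.pi fun _ : Fin d => laplaceMeasure (S / ε))) s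
          ≤ ENNReal.ofReal (Real.exp ε) *
            (Measure.map (fun z => f D' + z)
              (Measure.pi fun _ : Fin d => laplaceMeasure (S / ε))) s := by
  intro D D' hD s hs
  have hl : 0 < S / ε := by positivity
  have hmap : ∀ v : Fin d → ℝ,
      Measure.map (fun z => v + z) (Measure.pi fun _ : Fin d => laplaceMeasure (S / ε)) =
        Measure.pi fun i => Measure.map (fun z => v i + z) (laplaceMeasure (S / ε)) := by
    intro v
    exact (Measure.pi_map_pi (μ := fun _ : Fin d => laplaceMeasure (S / ε))
      (f := fun i z => v i + z) (fun i => by fun_prop))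
  rw [hmap, hmap]
  refine pi_le_smul _ _ (fun i => ENNReal.ofReal (Real.exp (|f D i - f D' i| / (S / ε)))) _
    (by simp [Real.exp_pos]) ENNReal.ofReal_ne_top ?_
    (fun i => laplace_map_le _ _ _ hl) hs
  rw [← ENNReal.ofReal_prod_of_nonneg (fun i _ => (Real.exp_pos _).le), ← Real.exp_sum,
    ← Finset.sum_div]
  apply ENNReal.ofReal_le_ofReal
  rw [Real.exp_le_exp, div_le_iff₀ hl]
  have := hsens D D' hD
  have e : ε * (S / ε) = S := by field_simp
  linarith
end

section
/- Let X be a set, n, m, t, Δ positive integers, ε > 0, and η > 0. Let M be a mechanism assigning to each D ∈ X^n a probability measure M(D) on ℝ^t that provides ε-differential privacy. Let D_1, …, D_m ∈ X^n be databases such that every pair D_i, D_j differs in at most Δ entries, and let f : X^n → ℝ^t satisfy ‖f(D_i) − f(D_j)‖_∞ ≥ η for all i ≠ j. Then there exists an index i such that Pr[ ‖M(D_i) − f(D_i)‖_∞ < η/2 ] ≤ e^{εΔ}/m. -/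
open MeasureTheory Finset

/-- Group privacy. -/
theorem group_privacy_aux {X : Type*} {n t : ℕ} (ε : ℝ) (hε : 0 < ε)
    (M : (Fin n → X) → Measure (Fin t → ℝ))
    (hdp : ∀ D D' : Fin n → X, Neighboring D D' →
      ∀ s : Set (Fin t → ℝ), MeasurableSet s →
        M D s ≤ ENNReal.ofReal (Real.exp ε) * M D' s)
    (s : Set (Fin t → ℝ)) (hs : MeasurableSet s) (k : ℕ) :
    ∀ D D' : Fin n → X, {idx : Fin n | D idx ≠ D' idx}.ncard ≤ k →
      M D s ≤ ENNReal.ofReal (Real.exp ε) ^ k * M D' s := by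
  classical
  have h1 : 1 ≤ ENNReal.ofReal (Real.exp ε) := by
    rw [ENNReal.one_le_ofReal]
    exact Real.one_le_exp hε.le
  induction k with
  | zero =>
    intro D D' h
    have h0 : {idx : Fin n | D idx ≠ D' idx} = ∅ :=
      (Set.ncard_eq_zero (Set.toFinite _)).1 (Nat.le_zero.1 h)
    have : D = D' := by
      funext i
      by_contra hi
      have : i ∈ {idx : Fin n | D idx ≠ D' idx} := hi
      rw [h0] at this
      exact this
    simp [this]
  | succ k ih =>
    intro D D' h
    by_cases hD : D = D'
    · subst hD
      exact le_mul_of_one_le_left' (one_le_pow_of_one_le' h1 _)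
    · obtain ⟨i, hi⟩ := Function.ne_iff.1 hD
      have hN : Neighboring D (Function.update D i (D' i)) :=
        ⟨i, fun j hj => by simp [hj]⟩
      have hsub : {idx : Fin n | Function.update D i (D' i) idx ≠ D' idx}
          = {idx : Fin n | D idx ≠ D' idx} \ {i} := by
        ext j
        by_cases hj : j = i
        · subst hj; simp
        · simp [hj]
      have hc : {idx : Fin n | Function.update D i (D' i) idx ≠ D' idx}.ncard ≤ k := by
        rw [hsub, Set.ncard_sdiff_singleton_of_mem (by exact hi)]
        omega
      calc M D s ≤ _ := hdp _ _ hN s hs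
        _ ≤ ENNReal.ofReal (Real.exp ε) * (ENNReal.ofReal (Real.exp ε) ^ k * M D' s) := by
          gcongr
          exact ih _ _ hc
        _ = _ := by rw [pow_succ', mul_assoc]

/-- **Lower-bound lemma (De 2012).** Let `M` be an `ε`-differentially private mechanism
with responses in `ℝ^t` (with the sup norm `‖·‖_∞`), and let `D_1, …, D_m` be databases
any two of which differ in at most `Δ` entries. If `f : X^n → ℝ^t` satisfies
`‖f(D_i) − f(D_j)‖_∞ ≥ η` for all `i ≠ j`, then for some index `i`,
`Pr[‖M(D_i) − f(D_i)‖_∞ < η/2] ≤ e^{εΔ}/m`. -/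
theorem dp_packing_lower_bound
    {X : Type*} (n m t Δ : ℕ) (hn : 0 < n) (hm : 0 < m) (ht : 0 < t) (hΔ : 0 < Δ)
    (ε η : ℝ) (hε : 0 < ε) (hη : 0 < η)
    (M : (Fin n → X) → Measure (Fin t → ℝ))
    (hprob : ∀ D, IsProbabilityMeasure (M D))
    (hdp : ∀ D D' : Fin n → X, Neighboring D D' →
      ∀ s : Set (Fin t → ℝ), MeasurableSet s →
        M D s ≤ ENNReal.ofReal (Real.exp ε) * M D' s)
    (D : Fin m → (Fin n → X))
    (hdist : ∀ i j : Fin m, {idx : Fin n | D i idx ≠ D j idx}.ncard ≤ Δ)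
    (f : (Fin n → X) → (Fin t → ℝ))
    (hsep : ∀ i j : Fin m, i ≠ j → η ≤ ‖f (D i) - f (D j)‖) :
    ∃ i : Fin m,
      M (D i) {z : Fin t → ℝ | ‖z - f (D i)‖ < η / 2}
        ≤ ENNReal.ofReal (Real.exp (ε * Δ) / m) := by
  classical
  set B : Fin m → Set (Fin t → ℝ) := fun i => {z | ‖z - f (D i)‖ < η / 2} with hB
  have hBm : ∀ i, MeasurableSet (B i) := fun i =>
    (isOpen_lt (by fun_prop) (by fun_prop)).measurableSet
  have hdisj : Pairwise (Function.onFun Disjoint B) := by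
    intro i j hij
    refine Set.disjoint_left.2 fun z hi hj => ?_
    have hi' : ‖z - f (D i)‖ < η / 2 := hi
    have hj' : ‖z - f (D j)‖ < η / 2 := hj
    have h1 := hsep i j hij
    have h2 : ‖f (D i) - f (D j)‖ ≤ ‖z - f (D j)‖ + ‖z - f (D i)‖ := by
      have := norm_sub_le (z - f (D j)) (z - f (D i))
      rwa [sub_sub_sub_cancel_left] at this
    linarith
  have : IsProbabilityMeasure (M (D ⟨0, hm⟩)) := hprob _
  have hsum : ∑ i, M (D ⟨0, hm⟩) (B i) ≤ 1 := by
    rw [← tsum_fintype (L := .unconditional _), ← measure_iUnion hdisj hBm]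
    exact prob_le_one
  have key : ∑ i, M (D i) (B i) ≤ ∑ _i : Fin m, ENNReal.ofReal (Real.exp (ε * Δ) / m) := by
    calc ∑ i, M (D i) (B i)
        ≤ ∑ i, ENNReal.ofReal (Real.exp ε) ^ Δ * M (D ⟨0, hm⟩) (B i) :=
          Finset.sum_le_sum fun i _ =>
            group_privacy_aux ε hε M hdp (B i) (hBm i) Δ _ _ (hdist i _)
      _ = ENNReal.ofReal (Real.exp ε) ^ Δ * ∑ i, M (D ⟨0, hm⟩) (B i) := by
          rw [Finset.mul_sum]
      _ ≤ ENNReal.ofReal (Real.exp ε) ^ Δ * 1 := by gcongr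
      _ = _ := by
          have hm' : (m : ℝ) ≠ 0 := by positivity
          rw [mul_one, Finset.sum_const, Finset.card_univ, Fintype.card_fin,
            ← ENNReal.ofReal_nsmul, ← ENNReal.ofReal_pow (Real.exp_pos _).le,
            ← Real.exp_nat_mul, nsmul_eq_mul, mul_div_cancel₀ _ hm', mul_comm ε]
  obtain ⟨i, -, hi⟩ := ENNReal.exists_le_of_sum_le ⟨⟨0, hm⟩, Finset.mem_univ _⟩ key
  exact ⟨i, hi⟩
end
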